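/- arXiv:1207.2335 — 3 statements merged into one kernel-verified Lean document; each statement's English description precedes it below -/
import Mathlib

section
/- Let G be a bipartite graph and let S be a finite nonempty set of left vertices, each of degree at most d. If |N(S)| > (d/2)|S|, then there exists a right vertex adjacent to exactly one vertex of S (i.e., an S-leaf node exists). -/
/- STATEMENT 3: In a bipartite graph, if `S` is a finite nonempty set of left vertices, each
of degree at most `d`, and `|N(S)| > (d/2)|S|`, then some right vertex is adjacent to exactly
one vertex of `S` (an `S`-leaf node exists). -/
open Classical in
theorem stmt3 {V W : Type*} [Fintype W] (Adj : V → W → Prop) (d : ℕ)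
    (S : Finset V) (hS : S.Nonempty)
    (hdeg : ∀ j ∈ S, ((Finset.univ : Finset W).filter (fun i => Adj j i)).card ≤ d)
    (hexp : (d : ℝ) / 2 * S.card <
      (((Finset.univ : Finset W).filter (fun i => ∃ j ∈ S, Adj j i)).card : ℝ)) :
    ∃ i : W, (S.filter (fun j => Adj j i)).card = 1 := by
  by_contra! hleaf
  have hcount : (Finset.univ.filter (fun i => ∃ j ∈ S, Adj j i)).card * 2 ≤ S.card * d := by
    refine Finset.card_mul_le_card_mul' Adj (fun i hi => ?_) (fun j hj => ?_)
    · obtain ⟨j, hj, hji⟩ := (Finset.mem_filter.1 hi).2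
      have hpos : 0 < (S.filter (fun j => Adj j i)).card :=
        Finset.card_pos.2 ⟨j, Finset.mem_filter.2 ⟨hj, hji⟩⟩
      have hne := hleaf i
      unfold Finset.bipartiteBelow
      omega
    · exact (Finset.card_le_card
        (Finset.filter_subset_filter _ (Finset.subset_univ _))).trans (hdeg j hj)
  have hcount' : ((Finset.univ.filter (fun i => ∃ j ∈ S, Adj j i)).card : ℝ) * 2 ≤
      S.card * d := by
    exact_mod_cast hcount
  linarith
end

section
/- Fix an integer d ≥ 7. There exist constants c₀ > 0 (depending only on d) and, for each integer c ≥ c₀, a constant C > 0 (depending only on d and c) such that the following holds for all positive integers k ≤ n with ck dividing dn. Let G be a random (d, dn/(ck))-biregular bipartite multigraph on n left vertices and m' = ck right vertices generated by the configuration model, and fix any set S of k left vertices. Then with probability at least 1 − C·k^{-d/6}, every nonempty subset S' ⊆ S has at least (d/3)|S'| ≥ 1 right vertices that are S'-leaf nodes (each adjacent to exactly one vertex of S'); in particular, iterative peeling of the non-zero coordinates indexed by S succeeds. -/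
open Finset in
/-- A uniformly random permutation maps `A` into `B` with probability at most
`(#B / #α) ^ #A`. -/
theorem card_perm_mapsTo_le {α : Type*} [Fintype α] [DecidableEq α] (A B : Finset α) :
    Fintype.card α ^ #A * #{π : Equiv.Perm α | ∀ a ∈ A, π a ∈ B}
      ≤ #B ^ #A * (Fintype.card α).factorial := by
  induction A using Finset.induction_on with
  | empty => simp [Fintype.card_perm]
  | insert x A hx ih =>
    set E : Finset (Equiv.Perm α) := {π | ∀ a ∈ A, π a ∈ B} with hE
    have hswap : ∀ y ∈ Aᶜ, #{π ∈ E | π y ∈ B} = #{π ∈ E | π x ∈ B} := by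
      intro y hy
      rw [mem_compl] at hy
      have hfix : ∀ a ∈ A, Equiv.swap x y a = a := fun a ha =>
        Equiv.swap_apply_of_ne_of_ne (fun h => hx (h ▸ ha)) (fun h => hy (h ▸ ha))
      refine card_bij' (fun π _ => π * Equiv.swap x y) (fun π _ => π * Equiv.swap x y)
        ?_ ?_ ?_ ?_
      · intro π hπ
        simp only [hE, mem_filter, mem_univ, true_and, Equiv.Perm.mul_apply,
          Equiv.swap_apply_left] at hπ ⊢
        exact ⟨fun a ha => by rw [hfix a ha]; exact hπ.1 a ha, hπ.2⟩
      · intro π hπ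
        simp only [hE, mem_filter, mem_univ, true_and, Equiv.Perm.mul_apply,
          Equiv.swap_apply_right] at hπ ⊢
        exact ⟨fun a ha => by rw [hfix a ha]; exact hπ.1 a ha, hπ.2⟩
      · intro π _; simp [mul_assoc]
      · intro π _; simp [mul_assoc]
    have hcount : ∀ π ∈ E, #{y ∈ Aᶜ | π y ∈ B} + #A = #B := by
      intro π hπ
      simp only [hE, mem_filter, mem_univ, true_and] at hπ
      have h1 : #{y | π y ∈ B} = #B :=
        card_bij' (fun y _ => π y) (fun y _ => π.symm y) (by simp) (by simp) (by simp) (by simp)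
      rw [← h1, ← card_union_of_disjoint]
      · congr 1
        ext y
        simp only [mem_union, mem_filter, mem_compl, mem_univ, true_and]
        exact ⟨fun h => h.elim And.right (hπ y), fun h => by tauto⟩
      · rw [disjoint_left]
        intro y hy
        simp only [mem_filter, mem_compl] at hy
        exact hy.1
    have hdouble : #Aᶜ * #{π ∈ E | π x ∈ B} = ∑ π ∈ E, #{y ∈ Aᶜ | π y ∈ B} := by
      rw [← smul_eq_mul, ← sum_const, ← sum_congr rfl hswap]
      exact sum_card_bipartiteAbove_eq_sum_card_bipartiteBelow (fun y (π : Equiv.Perm α) => π y ∈ B)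
    have hBN : #B ≤ Fintype.card α := card_le_univ B
    have hAN : #A < Fintype.card α := card_lt_univ_of_notMem hx
    have hstep : Fintype.card α * #{π ∈ E | π x ∈ B} ≤ #B * #E := by
      have hEA : ∑ π ∈ E, #{y ∈ Aᶜ | π y ∈ B} = (#B - #A) * #E := by
        rw [sum_congr rfl (fun π hπ => Nat.eq_sub_of_add_eq (hcount π hπ)), sum_const,
          smul_eq_mul, mul_comm]
      rw [hEA, card_compl] at hdouble
      obtain ⟨z, hz⟩ := Nat.exists_eq_add_of_lt hAN
      rw [hz] at hdouble hBN ⊢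
      rw [add_assoc, Nat.add_sub_cancel_left] at hdouble
      refine Nat.le_of_mul_le_mul_left ?_ z.succ_pos
      calc (z + 1) * ((#A + z + 1) * #{π ∈ E | π x ∈ B})
          = ((#A + z + 1) * (#B - #A)) * #E := by rw [mul_left_comm, hdouble, mul_assoc]
        _ ≤ ((z + 1) * #B) * #E := by
            refine Nat.mul_le_mul_right _ ?_
            rcases le_total #B #A with h | h
            · simp [Nat.sub_eq_zero_of_le h]
            · obtain ⟨w, hw⟩ := Nat.exists_eq_add_of_le h
              rw [hw] at hBN ⊢
              rw [Nat.add_sub_cancel_left]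
              nlinarith
        _ = _ := mul_assoc _ _ _
    have hins : ({π : Equiv.Perm α | ∀ a ∈ insert x A, π a ∈ B} : Finset _)
        = {π ∈ E | π x ∈ B} := by
      ext π
      simp [hE, and_comm]
    rw [hins, card_insert_of_notMem hx, pow_succ, pow_succ]
    calc Fintype.card α ^ #A * Fintype.card α * #{π ∈ E | π x ∈ B}
        = Fintype.card α ^ #A * (Fintype.card α * #{π ∈ E | π x ∈ B}) := mul_assoc _ _ _
      _ ≤ Fintype.card α ^ #A * (#B * #E) := Nat.mul_le_mul_left _ hstep
      _ = #B * (Fintype.card α ^ #A * #E) := by ring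
      _ ≤ #B * (#B ^ #A * (Fintype.card α).factorial) := Nat.mul_le_mul_left _ ih
      _ = _ := by ring

open Finset in
theorem card_fin_div_mem {N q r : ℕ} (hr : 0 < r) (hN : N = q * r) {U : Finset ℕ}
    (hU : U ⊆ range q) : #{h : Fin N | h.val / r ∈ U} = #U * r := by
  rw [← card_range r, ← card_product, card_range]
  refine card_bij (fun h _ => (h.val / r, h.val % r)) ?_ ?_ ?_
  · intro h hh
    simp only [mem_filter, mem_univ, true_and] at hh
    simpa [hh] using Nat.mod_lt _ hr
  · intro a _ b _ hab
    simp only [Prod.mk.injEq] at hab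
    rw [Fin.ext_iff, ← Nat.div_add_mod a.val r, ← Nat.div_add_mod b.val r, hab.1, hab.2]
  · rintro ⟨u, i⟩ hui
    simp only [mem_product, mem_range] at hui
    have hu := mem_range.1 (hU hui.1)
    have hlt : r * u + i < N := by
      rw [hN]
      nlinarith
    have hdiv : (r * u + i) / r = u := by
      rw [Nat.mul_add_div hr, Nat.div_eq_of_lt hui.2, add_zero]
    refine ⟨⟨r * u + i, hlt⟩, by simpa [hdiv] using hui.1, ?_⟩
    simp [hdiv, Nat.mod_eq_of_lt hui.2]

open Finset in
/-- If `S'` has few leaf nodes, then its neighbourhood is contained in a small set. The edges are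
indexed by `H`, and `u`, `v` give their left and right endpoints. -/
theorem exists_superset_neighbors {H : Type*} [Fintype H] (u v : H → ℕ)
    [∀ rv j, Decidable (∃ h, u h = j ∧ v h = rv)] {S' R : Finset ℕ}
    (hv : ∀ h, v h ∈ R) {D t : ℕ} (hD : #{h | u h ∈ S'} ≤ D)
    (hL : 3 * #{rv ∈ R | #{j ∈ S' | ∃ h, u h = j ∧ v h = rv} = 1} < D)
    (ht : 2 * D / 3 ≤ t) (htR : t ≤ #R) :
    ∃ T ∈ powersetCard t R, ∀ h, u h ∈ S' → v h ∈ T := by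
  set f : ℕ → ℕ := fun rv => #{j ∈ S' | ∃ h, u h = j ∧ v h = rv} with hf
  have hL' : 3 * #{rv ∈ R | f rv = 1} < D := hL
  have hsum : ∑ rv ∈ R, f rv ≤ D := by
    refine le_trans ?_ hD
    rw [hf, ← card_sigma]
    refine le_trans (card_le_card (t := image (fun h => (⟨v h, u h⟩ : Σ _ : ℕ, ℕ))
      {h | u h ∈ S'}) ?_) card_image_le
    rintro ⟨rv, j⟩ hx
    simp only [mem_sigma, mem_filter] at hx
    obtain ⟨-, hj, h, rfl, rfl⟩ := hx
    exact mem_image.2 ⟨h, by simpa using hj, rfl⟩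
  have hcard : 2 * #{rv ∈ R | f rv ≠ 0} ≤ ∑ rv ∈ R, f rv + #{rv ∈ R | f rv = 1} := by
    rw [card_filter, card_filter, mul_sum, ← sum_add_distrib]
    refine sum_le_sum fun rv _ => ?_
    split_ifs <;> omega
  obtain ⟨T, hT1, hT2, hT3⟩ := exists_subsuperset_card_eq
    (filter_subset (fun rv => f rv ≠ 0) R) (n := t) (by omega) htR
  refine ⟨T, mem_powersetCard.2 ⟨hT2, hT3⟩, fun h hh => hT1 (mem_filter.2 ⟨hv h, ?_⟩)⟩
  exact (card_pos.2 ⟨u h, mem_filter.2 ⟨hh, h, rfl, rfl⟩⟩).ne'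

theorem choose_le_div_pow_mul_three_pow (m t : ℕ) (ht : 0 < t) :
    (m.choose t : ℝ) ≤ ((m : ℝ) / t) ^ t * 3 ^ t := by
  have h1 : (m.choose t : ℝ) ≤ (m : ℝ) ^ t / t.factorial := Nat.choose_le_pow_div t m
  have h2 : (t : ℝ) ^ t / t.factorial ≤ 3 ^ t := by
    refine (Real.pow_div_factorial_le_exp (t : ℝ) (by positivity) t).trans ?_
    rw [← mul_one (t : ℝ), Real.exp_nat_mul]
    exact pow_le_pow_left₀ (Real.exp_pos _).le (Real.exp_one_lt_three.le) _
  refine h1.trans ?_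
  have htp : (0 : ℝ) < (t : ℝ) ^ t := by positivity
  calc (m : ℝ) ^ t / t.factorial = ((m : ℝ) / t) ^ t * ((t : ℝ) ^ t / t.factorial) := by
        rw [div_pow]; field_simp
    _ ≤ _ := by gcongr

theorem choose_mul_choose_mul_pow_le {d c k s : ℕ} (hd : 7 ≤ d) (hc : 216 * d ≤ c) (hs : 0 < s)
    (hsk : s ≤ k) :
    (k.choose s : ℝ) * ((c * k).choose (2 * (s * d) / 3))
        * ((2 * (s * d) / 3 : ℕ) / (c * k : ℕ) : ℝ) ^ (s * d)
      ≤ (s : ℝ) ^ d * (1 / 2) ^ s * (k : ℝ) ^ (-(d : ℝ) / 6) := by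
  set t := 2 * (s * d) / 3 with ht_def
  have hsd : 7 ≤ s * d := by nlinarith
  have ht : 0 < t := by omega
  have ht3 : 3 * t ≤ 2 * (s * d) := by omega
  have hk : 0 < k := by omega
  have hc0 : 0 < c := by omega
  have hkR : (0 : ℝ) < k := by exact_mod_cast hk
  have hcR : (0 : ℝ) < c := by exact_mod_cast hc0
  have hsR : (1 : ℝ) ≤ s := by exact_mod_cast hs
  have hdR : (7 : ℝ) ≤ d := by exact_mod_cast hd
  have htR : (0 : ℝ) < t := by exact_mod_cast ht
  have ht3R : 3 * (t : ℝ) ≤ 2 * (s * d) := by exact_mod_cast ht3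
  have hcdR : 216 * (d : ℝ) ≤ c := by exact_mod_cast hc
  set x : ℝ := (s : ℝ) / k with hx
  have hx0 : 0 < x := by positivity
  have hx1 : x ≤ 1 := by
    rw [hx, div_le_one hkR]; exact_mod_cast hsk
  set y : ℝ := (t : ℝ) / (c * k : ℕ) with hy
  have hy0 : 0 < y := by rw [hy]; push_cast; positivity
  have hyx : y ≤ x / 216 := by
    rw [hy, hx, div_div, div_le_div_iff₀ (by push_cast; positivity) (by positivity)]
    push_cast
    have : (t : ℝ) * 216 ≤ s * c := by nlinarith
    nlinarith
  obtain ⟨w, hw⟩ : ∃ w, s * d = t + w := Nat.exists_eq_add_of_le (by omega)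
  have hwR : (s : ℝ) * d = t + w := by exact_mod_cast hw
  have hpow : y ^ w ≤ (x / 216) ^ ((s : ℝ) * d / 3) := by
    rw [← Real.rpow_natCast]
    refine (Real.rpow_le_rpow_of_exponent_ge hy0 (by linarith) (y := (w : ℝ))
      (z := (s : ℝ) * d / 3) (by linarith)).trans ?_
    exact Real.rpow_le_rpow hy0.le hyx (by positivity)
  have hsplit : (x / 216) ^ ((s : ℝ) * d / 3) = x ^ ((s : ℝ) * d / 3) * (1 / 6) ^ (s * d) := by
    rw [div_eq_mul_one_div, Real.mul_rpow hx0.le (by norm_num),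
      show (1 / 216 : ℝ) = (1 / 6) ^ (3 : ℝ) by norm_num, ← Real.rpow_mul (by norm_num),
      ← Real.rpow_natCast (1 / 6 : ℝ) (s * d)]
    congr 2
    push_cast
    ring
  have hck : ((c * k).choose t : ℝ) * y ^ (s * d) ≤ 3 ^ t * y ^ w := by
    rw [hw, pow_add, ← mul_assoc]
    refine mul_le_mul_of_nonneg_right ?_ (by positivity)
    refine (mul_le_mul_of_nonneg_right (choose_le_div_pow_mul_three_pow _ t ht)
      (by positivity)).trans_eq ?_
    rw [mul_right_comm, ← mul_pow, hy, div_mul_div_cancel₀ htR.ne', div_self, one_pow, one_mul]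
    exact_mod_cast (by positivity : 0 < c * k).ne'
  have hks : (k.choose s : ℝ) ≤ x ^ (-(s : ℝ)) * 3 ^ s := by
    refine (choose_le_div_pow_mul_three_pow k s hs).trans_eq ?_
    rw [Real.rpow_neg hx0.le, Real.rpow_natCast, ← inv_pow, hx, inv_div]
  have hconst : (3 : ℝ) ^ s * 3 ^ t * (1 / 6) ^ (s * d) ≤ (1 / 2) ^ s := by
    have h1 : (3 : ℝ) ^ s * 3 ^ t ≤ 3 ^ (s * d) := by
      rw [← pow_add]
      refine pow_le_pow_right₀ (by norm_num) ?_
      have : s * 7 ≤ s * d := Nat.mul_le_mul_left s hd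
      omega
    calc (3 : ℝ) ^ s * 3 ^ t * (1 / 6) ^ (s * d) ≤ 3 ^ (s * d) * (1 / 6) ^ (s * d) := by gcongr
      _ = (1 / 2) ^ (s * d) := by rw [← mul_pow]; norm_num
      _ ≤ (1 / 2) ^ s := pow_le_pow_of_le_one (by norm_num) (by norm_num)
          (Nat.le_mul_of_pos_right s (by omega))
  have hxpow : x ^ (-(s : ℝ)) * x ^ ((s : ℝ) * d / 3)
      ≤ (s : ℝ) ^ d * (k : ℝ) ^ (-(d : ℝ) / 6) := by
    rw [← Real.rpow_add hx0]
    calc x ^ (-(s : ℝ) + (s : ℝ) * d / 3) ≤ x ^ ((d : ℝ) / 6) :=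
          Real.rpow_le_rpow_of_exponent_ge hx0 hx1 (by nlinarith)
      _ = (s : ℝ) ^ ((d : ℝ) / 6) * (k : ℝ) ^ (-(d : ℝ) / 6) := by
          rw [hx, Real.div_rpow (by positivity) hkR.le, neg_div, Real.rpow_neg hkR.le,
            div_eq_mul_inv]
      _ ≤ _ := by
          refine mul_le_mul_of_nonneg_right ?_ (by positivity)
          rw [← Real.rpow_natCast]
          exact Real.rpow_le_rpow_of_exponent_le hsR (by linarith)
  calc (k.choose s : ℝ) * ((c * k).choose t) * y ^ (s * d)
      = (k.choose s : ℝ) * (((c * k).choose t) * y ^ (s * d)) := mul_assoc _ _ _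
    _ ≤ (x ^ (-(s : ℝ)) * 3 ^ s) * (3 ^ t * (x ^ ((s : ℝ) * d / 3) * (1 / 6) ^ (s * d))) := by
        rw [← hsplit]
        exact mul_le_mul hks (hck.trans (mul_le_mul_of_nonneg_left hpow (by positivity)))
          (by positivity) (by positivity)
    _ = (x ^ (-(s : ℝ)) * x ^ ((s : ℝ) * d / 3)) * (3 ^ s * 3 ^ t * (1 / 6) ^ (s * d)) := by ring
    _ ≤ ((s : ℝ) ^ d * (k : ℝ) ^ (-(d : ℝ) / 6)) * (1 / 2) ^ s := by gcongr
    _ = _ := by ring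


/- STATEMENT 5: For every integer `d ≥ 7` there is a constant `c₀ > 0` and, for each integer
`c ≥ c₀`, a constant `C > 0` such that for all `0 < k ≤ n` with `c*k ∣ d*n`, for a random
`(d, dn/(ck))`-biregular bipartite multigraph generated by the configuration model (a
uniformly random matching, i.e. permutation, of the `d*n` left half-edges with the `d*n`
right half-edges, where left half-edge `h` belongs to left vertex `h / d` and right
half-edge `h'` belongs to right vertex `h' / (d*n/(c*k))`), and any fixed set `S` of `k`
left vertices: with probability at least `1 - C·k^{-d/6}`, every nonempty `S' ⊆ S` has at
least `(d/3)|S'| ≥ 1` right vertices that are `S'`-leaf nodes (each adjacent to exactly one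
vertex of `S'`). -/
open Classical in
theorem stmt5 (d : ℕ) (hd : 7 ≤ d) :
    ∃ c₀ : ℕ, 0 < c₀ ∧
      ∀ c : ℕ, c₀ ≤ c →
        ∃ C : ℝ, 0 < C ∧
          ∀ n k : ℕ, 0 < k → k ≤ n → c * k ∣ d * n →
            ∀ S : Finset ℕ, S ⊆ Finset.range n → S.card = k →
              1 - C * (k : ℝ) ^ (-(d : ℝ) / 6) ≤
                (((Finset.univ : Finset (Equiv.Perm (Fin (d * n)))).filter
                    (fun π => ∀ S' ⊆ S, S'.Nonempty →
                      ((d : ℝ) / 3 * S'.card ≤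
                        (((Finset.range (c * k)).filter (fun rv =>
                            (S'.filter (fun j => ∃ h : Fin (d * n),
                                h.val / d = j ∧ (π h).val / (d * n / (c * k)) = rv)).card
                              = 1)).card : ℝ)) ∧
                      1 ≤ ((Finset.range (c * k)).filter (fun rv =>
                            (S'.filter (fun j => ∃ h : Fin (d * n),
                                h.val / d = j ∧ (π h).val / (d * n / (c * k)) = rv)).card
                              = 1)).card)).card : ℝ)
                  / (Fintype.card (Equiv.Perm (Fin (d * n))) : ℝ) := by
  refine ⟨216 * d, by omega, fun c hc => ⟨∑' s : ℕ, (s : ℝ) ^ d * (1 / 2) ^ s + 1,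
    by positivity, fun n k hk hkn hdvd S hS hSk => ?_⟩⟩
  have hc0 : 0 < c := by omega
  have hm : 0 < c * k := by positivity
  have hN : 0 < d * n := Nat.mul_pos (by omega) (by omega)
  set Δ := d * n / (c * k) with hΔ
  have hΔN : d * n = c * k * Δ := (Nat.mul_div_cancel' hdvd).symm
  have hΔ0 : 0 < Δ := Nat.pos_of_mul_pos_left (hΔN ▸ hN)
  set good : Equiv.Perm (Fin (d * n)) → Prop := fun π => ∀ S' ⊆ S, S'.Nonempty →
    ((d : ℝ) / 3 * S'.card ≤
      (((Finset.range (c * k)).filter (fun rv =>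
          (S'.filter (fun j => ∃ h : Fin (d * n),
              h.val / d = j ∧ (π h).val / Δ = rv)).card
            = 1)).card : ℝ)) ∧
    1 ≤ ((Finset.range (c * k)).filter (fun rv =>
          (S'.filter (fun j => ∃ h : Fin (d * n),
              h.val / d = j ∧ (π h).val / Δ = rv)).card
            = 1)).card with hgood
  let A : Finset ℕ → Finset (Fin (d * n)) := fun S' => {h | h.val / d ∈ S'}
  let B : Finset ℕ → Finset (Fin (d * n)) := fun T => {h | h.val / Δ ∈ T}
  let E : Finset ℕ → Finset ℕ → Finset (Equiv.Perm (Fin (d * n))) :=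
    fun S' T => {π | ∀ h ∈ A S', π h ∈ B T}
  have hA : ∀ S' ⊆ S, (A S').card = S'.card * d := fun S' hS' =>
    card_fin_div_mem (by omega) (mul_comm d n) (hS'.trans hS)
  have hB : ∀ T ⊆ Finset.range (c * k), (B T).card = T.card * Δ := fun T hT =>
    card_fin_div_mem hΔ0 hΔN hT
  have hbad : (Finset.univ.filter fun π => ¬ good π) ⊆ (Finset.Icc 1 k).biUnion fun s =>
      (Finset.powersetCard s S).biUnion fun S' =>
        (Finset.powersetCard (2 * (s * d) / 3) (Finset.range (c * k))).biUnion (E S') := by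
    intro π hπ
    simp only [hgood, Finset.mem_filter, Finset.mem_univ, true_and, not_forall] at hπ
    obtain ⟨S', hS', hne, hbad⟩ := hπ
    have hs1 : 1 ≤ S'.card := hne.card_pos
    have hsk : S'.card ≤ k := hSk ▸ Finset.card_le_card hS'
    have hsd : S'.card * d ≤ c * k := by nlinarith
    obtain ⟨T, hT, hmem⟩ := exists_superset_neighbors (fun h : Fin (d * n) => h.val / d)
      (fun h => (π h).val / Δ) (S' := S') (R := Finset.range (c * k))
      (fun h => Finset.mem_range.2 (Nat.div_lt_of_lt_mul 
        ((π h).isLt.trans_eq (hΔN.trans (mul_comm _ _))))) (hA S' hS').le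
      (t := 2 * (S'.card * d) / 3) (by
        by_contra hcon
        rw [not_lt] at hcon
        apply hbad
        refine ⟨?_, ?_⟩
        · have hcon' := (Nat.cast_le (α := ℝ)).2 hcon
          push_cast at hcon'
          linarith
        · have : 1 * 7 ≤ S'.card * d := Nat.mul_le_mul hs1 hd
          omega) le_rfl (by rw [Finset.card_range]; omega)
    simp only [Finset.mem_biUnion, Finset.mem_Icc]
    refine ⟨S'.card, ⟨hs1, hsk⟩, S', Finset.mem_powersetCard.2 ⟨hS', rfl⟩, T, hT, ?_⟩
    simp only [E, A, B, Finset.mem_filter, Finset.mem_univ, true_and]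
    exact hmem
  have hFpos : (0 : ℝ) < (d * n).factorial := by exact_mod_cast Nat.factorial_pos _
  have hE : ∀ s, ∀ S' ∈ Finset.powersetCard s S,
      ∀ T ∈ Finset.powersetCard (2 * (s * d) / 3) (Finset.range (c * k)),
      ((E S' T).card : ℝ) ≤ ((2 * (s * d) / 3 : ℕ) / (c * k : ℕ) : ℝ) ^ (s * d)
        * (d * n).factorial := by
    intro s S' hS' T hT
    rw [Finset.mem_powersetCard] at hS' hT
    have h : Fintype.card (Fin (d * n)) ^ (A S').card * (E S' T).card
        ≤ (B T).card ^ (A S').card * (Fintype.card (Fin (d * n))).factorial := by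
      convert card_perm_mapsTo_le (A S') (B T)
    rw [hA S' hS'.1, hB T hT.1, hS'.2, hT.2, Fintype.card_fin] at h
    have h' := (Nat.cast_le (α := ℝ)).2 h
    have hΔR : (Δ : ℝ) ≠ 0 := by exact_mod_cast hΔ0.ne'
    have hbase : ((2 * (s * d) / 3 : ℕ) / (c * k : ℕ) : ℝ)
        = ((2 * (s * d) / 3 * Δ : ℕ) : ℝ) / (d * n : ℕ) := by
      rw [hΔN, Nat.cast_mul (2 * (s * d) / 3), Nat.cast_mul (c * k), mul_div_mul_right _ _ hΔR]
    have hNR : (0 : ℝ) < ((d * n : ℕ) : ℝ) ^ (s * d) := by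
      have : (0 : ℝ) < ((d * n : ℕ) : ℝ) := by exact_mod_cast hN
      positivity
    rw [hbase, div_pow, div_mul_eq_mul_div, le_div_iff₀ hNR, mul_comm]
    rw [Nat.cast_mul, Nat.cast_mul (_ ^ _), Nat.cast_pow, Nat.cast_pow] at h'
    exact h'
  have hsummable : Summable fun s : ℕ => (s : ℝ) ^ d * (1 / 2) ^ s :=
    summable_pow_mul_geometric_of_norm_lt_one d (by norm_num)
  have hkpow : (0 : ℝ) ≤ (k : ℝ) ^ (-(d : ℝ) / 6) := by positivity
  have hbadcard : ((Finset.univ.filter fun π => ¬ good π).card : ℝ)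
      ≤ (∑' s : ℕ, (s : ℝ) ^ d * (1 / 2) ^ s + 1) * (k : ℝ) ^ (-(d : ℝ) / 6)
        * (d * n).factorial := by
    calc ((Finset.univ.filter fun π => ¬ good π).card : ℝ)
        ≤ ∑ s ∈ Finset.Icc 1 k, ∑ S' ∈ Finset.powersetCard s S,
          ∑ T ∈ Finset.powersetCard (2 * (s * d) / 3) (Finset.range (c * k)),
            ((E S' T).card : ℝ) := by
          refine le_trans (Nat.cast_le.2 (Finset.card_le_card hbad)) ?_
          norm_cast
          exact Finset.card_biUnion_le.trans (Finset.sum_le_sum fun s _ =>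
            Finset.card_biUnion_le.trans (Finset.sum_le_sum fun S' _ =>
              Finset.card_biUnion_le))
      _ ≤ ∑ s ∈ Finset.Icc 1 k, ((s : ℝ) ^ d * (1 / 2) ^ s * (k : ℝ) ^ (-(d : ℝ) / 6))
            * (d * n).factorial := by
          refine Finset.sum_le_sum fun s hs => ?_
          rw [Finset.mem_Icc] at hs
          refine (Finset.sum_le_sum fun S' hS' => Finset.sum_le_sum (hE s S' hS')).trans ?_
          simp only [Finset.sum_const, Finset.card_powersetCard, Finset.card_range, hSk,
            nsmul_eq_mul]
          rw [← mul_assoc, ← mul_assoc]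
          exact mul_le_mul_of_nonneg_right
            (choose_mul_choose_mul_pow_le hd hc hs.1 hs.2) hFpos.le
      _ ≤ _ := by
          rw [← Finset.sum_mul, ← Finset.sum_mul]
          gcongr
          have := hsummable.sum_le_tsum (Finset.Icc 1 k) (fun s _ => by positivity)
          linarith
  have htotal : ((Finset.univ.filter good).card : ℝ)
      + (Finset.univ.filter fun π => ¬ good π).card = (d * n).factorial := by
    rw [← Nat.cast_add, Finset.card_filter_add_card_filter_not, Finset.card_univ,
      Fintype.card_perm, Fintype.card_fin]
  rw [Fintype.card_perm, Fintype.card_fin, le_div_iff₀ hFpos]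
  linarith
end

section
/- Let d ≥ 2 and l ≥ 2 be integers with d + l > 4. There exists a constant c*_{d,l} > 0 (independent of k and m) that is the threshold for the appearance of an l-core in a random d-uniform hypergraph G with k hyperedges on m vertices: for any constant c, as m → ∞ with k = ⌊cm⌋, if c < c*_{d,l} then G has an empty l-core with probability 1 − o(1), while if c > c*_{d,l} then there exists ε > 0 (depending on c, d, l) such that the l-core of G covers at least εm vertices with probability 1 − o(1). -/
namespace CoreThreshold

section

open Finset Filter Topology

/-- The expectation of `u X` for a binomial variable `X` with `j` trials of success
probability `r`. -/
noncomputable def binE (r : ℝ) : ℕ → (ℕ → ℝ) → ℝ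
  | 0, u => u 0
  | j + 1, u => r * binE r j (fun i => u (i + 1)) + (1 - r) * binE r j u

lemma binE_add (r : ℝ) (j : ℕ) (u v : ℕ → ℝ) :
    binE r j (fun i => u i + v i) = binE r j u + binE r j v := by
  induction j generalizing u v with
  | zero => rfl
  | succ j ih => simp only [binE, ih]; ring

lemma binE_const_mul (r : ℝ) (j : ℕ) (a : ℝ) (u : ℕ → ℝ) :
    binE r j (fun i => a * u i) = a * binE r j u := by
  induction j generalizing u with
  | zero => rfl
  | succ j ih => simp only [binE, ih]; ring

lemma binE_sub (r : ℝ) (j : ℕ) (u v : ℕ → ℝ) :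
    binE r j (fun i => u i - v i) = binE r j u - binE r j v := by
  induction j generalizing u v with
  | zero => rfl
  | succ j ih => simp only [binE, ih]; ring

lemma binE_sum {ι : Type*} (r : ℝ) (j : ℕ) (s : Finset ι) (u : ι → ℕ → ℝ) :
    binE r j (fun i => ∑ a ∈ s, u a i) = ∑ a ∈ s, binE r j (u a) := by
  induction j generalizing u with
  | zero => rfl
  | succ j ih => simp only [binE, ih, mul_sum, sum_add_distrib]

lemma binE_one (j : ℕ) (u : ℕ → ℝ) : binE 1 j u = u j := by
  induction j generalizing u with
  | zero => rfl
  | succ j ih => simp [binE, ih]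

lemma abs_binE_le {r B : ℝ} (h0 : 0 ≤ r) (h1 : r ≤ 1) {j : ℕ} {u : ℕ → ℝ}
    (hu : ∀ i ≤ j, |u i| ≤ B) : |binE r j u| ≤ B := by
  induction j generalizing u with
  | zero => exact hu 0 le_rfl
  | succ j ih =>
    have a1 := ih (u := fun i => u (i + 1)) (fun i hi => hu _ (by omega))
    have a2 := ih (u := u) (fun i hi => hu _ (by omega))
    rw [abs_le] at a1 a2 ⊢
    simp only [binE]
    constructor <;> nlinarith

lemma binE_mono {r : ℝ} (h0 : 0 ≤ r) (h1 : r ≤ 1) {j : ℕ} {u v : ℕ → ℝ}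
    (h : ∀ i ≤ j, u i ≤ v i) : binE r j u ≤ binE r j v := by
  induction j generalizing u v with
  | zero => exact h 0 le_rfl
  | succ j ih =>
    have a1 := ih (u := fun i => u (i + 1)) (v := fun i => v (i + 1)) (fun i hi => h _ (by omega))
    have a2 := ih (u := u) (v := v) (fun i hi => h _ (by omega))
    simp only [binE]
    have : 0 ≤ 1 - r := by linarith
    gcongr

lemma binE_eq_zero (r : ℝ) {j : ℕ} {u : ℕ → ℝ} (hu : ∀ i ≤ j, u i = 0) : binE r j u = 0 := by
  induction j generalizing u with
  | zero => exact hu 0 le_rfl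
  | succ j ih =>
    simp only [binE]
    rw [ih (fun i hi => hu _ (by omega)), ih (fun i hi => hu _ (by omega))]
    ring

/-- The forward difference of a sequence. -/
def diff (u : ℕ → ℝ) : ℕ → ℝ := fun i => u (i + 1) - u i

lemma binE_diff (r : ℝ) (j : ℕ) (u : ℕ → ℝ) :
    binE r j (diff u) = binE r j (fun i => u (i + 1)) - binE r j u :=
  binE_sub r j (fun i => u (i + 1)) u

lemma binE_succ (r : ℝ) (j : ℕ) (u : ℕ → ℝ) :
    binE r (j + 1) u = binE r j u + r * binE r j (diff u) := by
  simp only [binE, binE_diff]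
  ring

lemma abs_diff_diff_le {u : ℕ → ℝ} {B : ℝ} (hu : ∀ i, |diff u i| ≤ B) (i : ℕ) :
    |diff (diff u) i| ≤ 2 * B := by
  have := hu i
  have := hu (i + 1)
  rw [abs_le] at *
  unfold diff at *
  constructor <;> linarith

lemma abs_binE_add_sub_le {r B : ℝ} (h0 : 0 ≤ r) (h1 : r ≤ 1) {u : ℕ → ℝ}
    (hu : ∀ i, |diff u i| ≤ B) (j e : ℕ) :
    |binE r (j + e) u - binE r j u| ≤ B * e := by
  induction e with
  | zero => simp
  | succ e ih =>
    have h2 := abs_binE_le h0 h1 (j := j + e) (fun i _ => hu i)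
    rw [← add_assoc, binE_succ]
    have : |r * binE r (j + e) (diff u)| ≤ B := by
      rw [abs_mul, abs_of_nonneg h0]
      nlinarith [abs_nonneg (binE r (j + e) (diff u))]
    push_cast
    rw [abs_le] at *
    constructor <;> linarith

lemma abs_binE_sub_binE_le {r r' B : ℝ} (h0 : 0 ≤ r) (h1 : r ≤ 1) (h0' : 0 ≤ r') (h1' : r' ≤ 1)
    {u : ℕ → ℝ} (hu : ∀ i, |diff u i| ≤ B) (j : ℕ) :
    |binE r' j u - binE r j u| ≤ B * |r' - r| * j := by
  induction j generalizing u with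
  | zero => simp [binE]
  | succ j ih =>
    have a1 := ih (u := fun i => u (i + 1)) (fun i => hu (i + 1))
    have a2 := ih hu
    have a3 := abs_binE_le h0' h1' (j := j) (fun i _ => hu i)
    have key : binE r' (j + 1) u - binE r (j + 1) u =
        (r' - r) * binE r' j (diff u) +
        (r * (binE r' j (fun i => u (i + 1)) - binE r j (fun i => u (i + 1))) +
          (1 - r) * (binE r' j u - binE r j u)) := by
      simp only [binE, binE_diff]
      ring
    rw [key]
    refine (abs_add_le _ _).trans ?_
    have b1 : |(r' - r) * binE r' j (diff u)| ≤ B * |r' - r| := by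
      rw [abs_mul, mul_comm]; gcongr
    have b2 : |r * (binE r' j (fun i => u (i + 1)) - binE r j (fun i => u (i + 1))) +
          (1 - r) * (binE r' j u - binE r j u)| ≤ B * |r' - r| * j := by
      rw [abs_le] at a1 a2 ⊢
      constructor <;> nlinarith
    push_cast
    linarith

lemma abs_binE_taylor_le {r r' B : ℝ} (h0 : 0 ≤ r) (h1 : r ≤ 1) (h0' : 0 ≤ r') (h1' : r' ≤ 1)
    {u : ℕ → ℝ} (hu : ∀ i, |diff u i| ≤ B) (j : ℕ) :
    |binE r' j u - binE r j u - (r' - r) * j * binE r (j - 1) (diff u)|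
      ≤ B * (r' - r) ^ 2 * j ^ 2 := by
  induction j generalizing u with
  | zero => simp [binE]
  | succ j ih =>
    have a1 := ih (u := fun i => u (i + 1)) (fun i => hu (i + 1))
    have a2 := ih hu
    have a3 := abs_binE_sub_binE_le h0 h1 h0' h1' (abs_diff_diff_le hu) j
    have hsplit : (j : ℝ) * binE r j (diff u) =
        r * (j * binE r (j - 1) (diff fun i => u (i + 1))) +
        (1 - r) * (j * binE r (j - 1) (diff u)) := by
      cases j with
      | zero => simp
      | succ n =>
        have : (diff fun i => u (i + 1)) = fun i => diff u (i + 1) := rfl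
        simp only [binE, Nat.add_sub_cancel, this]
        ring
    have key : binE r' (j + 1) u - binE r (j + 1) u
          - (r' - r) * (j + 1 : ℕ) * binE r (j + 1 - 1) (diff u) =
        (r' - r) * (binE r' j (diff u) - binE r j (diff u)) +
        (r * (binE r' j (fun i => u (i + 1)) - binE r j (fun i => u (i + 1))
            - (r' - r) * j * binE r (j - 1) (diff fun i => u (i + 1))) +
          (1 - r) * (binE r' j u - binE r j u - (r' - r) * j * binE r (j - 1) (diff u))) := by
      have hd := binE_diff r' j u
      simp only [binE, Nat.add_sub_cancel]
      push_cast
      rw [hd]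
      linear_combination (-(r' - r)) * hsplit
    rw [key]
    refine (abs_add_le _ _).trans ?_
    have b1 : |(r' - r) * (binE r' j (diff u) - binE r j (diff u))|
        ≤ 2 * B * (r' - r) ^ 2 * j := by
      rw [abs_mul]
      calc |r' - r| * |binE r' j (diff u) - binE r j (diff u)|
          ≤ |r' - r| * (2 * B * |r' - r| * j) := by gcongr
        _ = 2 * B * |r' - r| ^ 2 * j := by ring
        _ = _ := by rw [sq_abs]
    have b2 : |r * (binE r' j (fun i => u (i + 1)) - binE r j (fun i => u (i + 1))
            - (r' - r) * j * binE r (j - 1) (diff fun i => u (i + 1))) +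
          (1 - r) * (binE r' j u - binE r j u - (r' - r) * j * binE r (j - 1) (diff u))|
          ≤ B * (r' - r) ^ 2 * j ^ 2 := by
      rw [abs_le] at a1 a2 ⊢
      constructor <;> nlinarith
    have hB : 0 ≤ B := (abs_nonneg _).trans (hu 0)
    push_cast
    nlinarith [mul_nonneg hB (sq_nonneg (r' - r))]

lemma binE_choose (r : ℝ) (N q : ℕ) :
    binE r N (fun i => (i.choose q : ℝ)) = N.choose q * r ^ q := by
  induction N generalizing q with
  | zero => cases q <;> simp [binE]
  | succ N ih =>
    cases q with
    | zero =>
      have := ih 0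
      simp only [Nat.choose_zero_right, Nat.cast_one, pow_zero, mul_one] at this
      simp [binE, this]
    | succ q =>
      simp only [binE, Nat.choose_succ_succ, Nat.cast_add, binE_add, Nat.succ_eq_add_one, ih]
      ring

lemma binE_single (r : ℝ) (N q : ℕ) :
    binE r N (fun i => if i = q then 1 else 0) = N.choose q * r ^ q * (1 - r) ^ (N - q) := by
  induction N generalizing q with
  | zero => cases q <;> simp [binE]
  | succ N ih =>
    cases q with
    | zero =>
      simp only [binE, ih]
      rw [binE_eq_zero r (fun i _ => by simp)]
      simp [pow_succ]; ring
    | succ q =>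
      simp only [binE, ih, Nat.choose_succ_succ, Nat.add_right_cancel_iff, Nat.cast_add,
        Nat.succ_eq_add_one, Nat.add_sub_add_right]
      rcases Nat.lt_or_ge q N with h | h
      · have : N - q = N - (q + 1) + 1 := by omega
        rw [this]; ring
      · rw [Nat.choose_eq_zero_of_lt (show N < q + 1 by omega)]
        simp; ring

end

section

open Finset Filter Topology

/-- The number of elements of `S` labelled `v`. -/
def degIn {ι V : Type*} [DecidableEq V] (g : ι → V) (S : Finset ι) (v : V) : ℕ :=
  #{y ∈ S | g y = v}

section Labels

variable {V : Type*} [Fintype V]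

lemma sum_cons {n : ℕ} (F : (Fin (n + 1) → V) → ℝ) :
    ∑ f, F f = ∑ a : V, ∑ g : Fin n → V, F (Fin.cons a g) := by
  rw [← Fintype.sum_prod_type']
  exact (Fintype.sum_equiv (Fin.consEquiv fun _ => V) _ _ (fun _ => rfl)).symm

omit [Fintype V] in
lemma degIn_cons [DecidableEq V] {n : ℕ} (a v : V) (g : Fin n → V) :
    degIn (Fin.cons a g : Fin (n + 1) → V) univ v =
      (if a = v then 1 else 0) + degIn g univ v := by
  simp only [degIn, card_filter, Fin.sum_univ_succ, Fin.cons_zero, Fin.cons_succ]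

lemma sum_binE_degIn_fin [DecidableEq V] (r : ℝ) (v : V) (n : ℕ) (u : ℕ → ℝ) :
    ∑ g : Fin n → V, binE r (degIn g univ v) u =
      (Fintype.card V : ℝ) ^ n * binE (r / Fintype.card V) n u := by
  have hm : (Fintype.card V : ℝ) ≠ 0 := by
    have : Nonempty V := ⟨v⟩
    exact_mod_cast Fintype.card_ne_zero
  induction n generalizing u with
  | zero => simp [degIn, binE]
  | succ n ih =>
    rw [sum_cons, sum_comm]
    have key : ∀ g : Fin n → V, ∑ a : V, binE r (degIn (Fin.cons a g : Fin (n + 1) → V) univ v) u =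
        r * binE r (degIn g univ v) (fun i => u (i + 1)) +
          (Fintype.card V - r) * binE r (degIn g univ v) u := by
      intro g
      have h : ∀ a : V, binE r (degIn (Fin.cons a g : Fin (n + 1) → V) univ v) u =
          binE r (degIn g univ v) u + if a = v then
            r * (binE r (degIn g univ v) (fun i => u (i + 1)) - binE r (degIn g univ v) u)
            else 0 := by
        intro a
        rw [degIn_cons]
        split_ifs with h
        · rw [add_comm 1, binE_succ, binE_diff]
        · simp
      simp only [h, sum_add_distrib, sum_ite_eq', mem_univ, if_true, sum_const, card_univ,
        nsmul_eq_mul]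
      ring
    simp only [key, sum_add_distrib, ← mul_sum, ih, binE]
    field_simp
    ring

lemma variance_fin [Nonempty V] {B : ℝ} (n : ℕ) (F : (Fin n → V) → ℝ)
    (hF : ∀ (i : Fin n) (f f' : Fin n → V), (∀ j ≠ i, f j = f' j) → |F f - F f'| ≤ B) :
    ∑ f, (F f - (∑ f', F f') / (Fintype.card V : ℝ) ^ n) ^ 2 ≤
      n * B ^ 2 * (Fintype.card V : ℝ) ^ n := by
  have hm : (Fintype.card V : ℝ) ≠ 0 := by exact_mod_cast Fintype.card_ne_zero
  have hm0 : (0 : ℝ) < Fintype.card V := by positivity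
  induction n with
  | zero => simp
  | succ n ih =>
    set m : ℝ := (Fintype.card V : ℝ)
    let μ : V → ℝ := fun a => (∑ g : Fin n → V, F (Fin.cons a g)) / m ^ n
    have hμ : (∑ f', F f') / m ^ (n + 1) = (∑ a, μ a) / m := by
      rw [sum_cons]; simp only [μ, ← sum_div]; field_simp; ring
    rw [hμ, sum_cons]
    have hdev : ∀ a, (μ a - (∑ a, μ a) / m) ^ 2 ≤ B ^ 2 := by
      intro a
      have h1 : ∀ b, |μ a - μ b| ≤ B := by
        intro b
        simp only [μ, ← sub_div, ← sum_sub_distrib]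
        rw [abs_div, abs_of_pos (by positivity : 0 < m ^ n), div_le_iff₀ (by positivity)]
        refine (abs_sum_le_sum_abs _ _).trans ?_
        refine (sum_le_card_nsmul _ _ B ?_).trans (le_of_eq ?_)
        · intro g _
          refine hF 0 _ _ ?_
          intro j hj
          obtain ⟨i, rfl⟩ := Fin.exists_succ_eq.2 hj
          simp
        · simp [m, mul_comm]
      have h2 : μ a - (∑ a, μ a) / m = (∑ b, (μ a - μ b)) / m := by
        rw [sum_sub_distrib]; simp [m]; field_simp
      rw [← sq_abs (μ a - _)]
      have : |μ a - (∑ a, μ a) / m| ≤ B := by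
        rw [h2, abs_div, abs_of_pos hm0, div_le_iff₀ hm0]
        refine (abs_sum_le_sum_abs _ _).trans ?_
        refine (sum_le_card_nsmul _ _ B fun b _ => h1 b).trans (le_of_eq ?_)
        simp [m, mul_comm]
      gcongr
    have hin : ∀ a, ∑ g : Fin n → V, (F (Fin.cons a g) - (∑ a, μ a) / m) ^ 2 ≤
        (n + 1) * B ^ 2 * m ^ n := by
      intro a
      have e1 : ∀ g : Fin n → V, (F (Fin.cons a g) - (∑ a, μ a) / m) ^ 2 =
          (F (Fin.cons a g) - μ a) ^ 2 +
            2 * (μ a - (∑ a, μ a) / m) * (F (Fin.cons a g) - μ a) +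
            (μ a - (∑ a, μ a) / m) ^ 2 := by intro g; ring
      have e2 : ∑ g : Fin n → V, (F (Fin.cons a g) - μ a) = 0 := by
        rw [sum_sub_distrib]; simp [μ, m]; field_simp; simp
      simp only [e1, sum_add_distrib, ← mul_sum, e2, mul_zero, add_zero]
      have e3 := ih (fun g => F (Fin.cons a g)) (by
        intro i f f' h
        refine hF i.succ _ _ ?_
        intro j hj
        refine Fin.cases ?_ (fun j' => ?_) j hj
        · intro _; simp
        · intro hj'; simpa using h j' (by rintro rfl; exact hj' rfl))
      have e4 : ∑ g : Fin n → V, (μ a - (∑ a, μ a) / m) ^ 2 ≤ m ^ n * B ^ 2 := by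
        simp only [sum_const, card_univ, Fintype.card_pi_const, nsmul_eq_mul, Nat.cast_pow]
        exact mul_le_mul_of_nonneg_left (hdev a) (by positivity)
      have e5 : ∑ g : Fin n → V, (F (Fin.cons a g) - μ a) ^ 2 ≤ n * B ^ 2 * m ^ n := e3
      nlinarith
    refine (sum_le_card_nsmul _ _ _ fun a _ => hin a).trans (le_of_eq ?_)
    simp only [card_univ, nsmul_eq_mul, Nat.cast_add, Nat.cast_one, m]
    ring

variable {ι : Type*} [Fintype ι]

omit [Fintype V] in
lemma degIn_comp_equiv [DecidableEq V] {ι' : Type*} [Fintype ι'] (e : ι' ≃ ι) (g : ι → V) (v : V) :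
    degIn (g ∘ e) univ v = degIn g univ v := by
  simp only [degIn, card_filter]
  exact Fintype.sum_equiv e _ _ (fun _ => rfl)

lemma sum_binE_degIn [DecidableEq ι] [DecidableEq V] (r : ℝ) (v : V) (u : ℕ → ℝ) :
    ∑ g : ι → V, binE r (degIn g univ v) u =
      (Fintype.card V : ℝ) ^ Fintype.card ι *
        binE (r / Fintype.card V) (Fintype.card ι) u := by
  rw [← sum_binE_degIn_fin r v]
  refine Fintype.sum_equiv (Equiv.arrowCongr (Fintype.equivFin ι) (Equiv.refl V)) _ _ ?_
  intro g
  congr 1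
  exact (degIn_comp_equiv (Fintype.equivFin ι).symm g v).symm

lemma variance_le [DecidableEq ι] [Nonempty V] {B : ℝ} (F : (ι → V) → ℝ)
    (hF : ∀ (i : ι) (f f' : ι → V), (∀ j ≠ i, f j = f' j) → |F f - F f'| ≤ B) :
    ∑ f, (F f - (∑ f', F f') / (Fintype.card V : ℝ) ^ Fintype.card ι) ^ 2 ≤
      Fintype.card ι * B ^ 2 * (Fintype.card V : ℝ) ^ Fintype.card ι := by
  let e := Fintype.equivFin ι
  have hs : ∀ G : (ι → V) → ℝ, ∑ f, G f = ∑ f : Fin (Fintype.card ι) → V, G (f ∘ e) := by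
    intro G
    refine Fintype.sum_equiv (Equiv.arrowCongr e (Equiv.refl V)) _ _ ?_
    intro g
    congr 1
    ext y
    simp
  rw [hs, hs F]
  refine variance_fin (Fintype.card ι) (fun f => F (f ∘ e)) ?_
  intro i f f' h
  refine hF (e.symm i) _ _ ?_
  intro j hj
  exact h _ (by rintro rfl; simp at hj)

end Labels

end

section

open Finset

section Cylinder

variable {K : Type*} [Fintype K] [DecidableEq K] {d : ℕ}

/-- The permutations of the slots that agree with `π₀` on all hyperedges outside `I`. -/
def cyl (I : Finset K) (π₀ : Equiv.Perm (K × Fin d)) : Finset (Equiv.Perm (K × Fin d)) :=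
  {π | ∀ i ∉ I, ∀ a, π (i, a) = π₀ (i, a)}

/-- The labels that `π` assigns to the slots of hyperedges in `I`. -/
def alive (I : Finset K) (π : Equiv.Perm (K × Fin d)) : Finset (K × Fin d) :=
  {y | (π.symm y).1 ∈ I}

lemma mem_cyl {I : Finset K} {π₀ π : Equiv.Perm (K × Fin d)} :
    π ∈ cyl I π₀ ↔ ∀ i ∉ I, ∀ a, π (i, a) = π₀ (i, a) := by
  simp [cyl]

lemma mem_alive {I : Finset K} {π : Equiv.Perm (K × Fin d)} {y : K × Fin d} :
    y ∈ alive I π ↔ (π.symm y).1 ∈ I := by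
  simp [alive]

lemma cyl_univ (π : Equiv.Perm (K × Fin d)) : cyl univ π = univ := by
  ext; simp [mem_cyl]

lemma alive_univ (π : Equiv.Perm (K × Fin d)) : alive univ π = univ := by
  ext; simp [mem_alive]

lemma alive_eq_map (I : Finset K) (π : Equiv.Perm (K × Fin d)) :
    alive I π = (I ×ˢ univ).map π.toEmbedding := by
  ext y
  simp only [mem_alive, mem_map, mem_product, mem_univ, and_true, Equiv.coe_toEmbedding]
  constructor
  · intro h; exact ⟨π.symm y, h, by simp⟩
  · rintro ⟨z, hz, rfl⟩; simpa using hz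

lemma card_alive (I : Finset K) (π : Equiv.Perm (K × Fin d)) : #(alive I π) = #I * d := by
  simp [alive_eq_map]

lemma symm_apply_of_mem_cyl {I : Finset K} {π₀ π : Equiv.Perm (K × Fin d)} (h : π ∈ cyl I π₀)
    {y : K × Fin d} (hy : y ∉ alive I π₀) : π.symm y = π₀.symm y := by
  rw [mem_alive] at hy
  have := mem_cyl.1 h _ hy (π₀.symm y).2
  rw [Equiv.symm_apply_eq, this]
  simp

lemma alive_of_mem_cyl {I : Finset K} {π₀ π : Equiv.Perm (K × Fin d)} (h : π ∈ cyl I π₀) :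
    alive I π = alive I π₀ := by
  have h' : π₀ ∈ cyl I π := mem_cyl.2 fun i hi a => (mem_cyl.1 h i hi a).symm
  ext y
  constructor
  · intro hy
    by_contra hn
    have := symm_apply_of_mem_cyl h hn
    rw [mem_alive] at hy hn
    exact hn (this ▸ hy)
  · intro hy
    by_contra hn
    have := symm_apply_of_mem_cyl h' hn
    rw [mem_alive] at hy hn
    exact hn (this ▸ hy)

lemma sum_cyl_le {I : Finset K} {π₀ : Equiv.Perm (K × Fin d)} (x : K × Fin d)
    {F G : Equiv.Perm (K × Fin d) → ℝ}
    (h : ∀ π₁ ∈ cyl I π₀, ∑ π ∈ cyl (I.erase (π₁.symm x).1) π₁, F π ≤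
      ∑ π ∈ cyl (I.erase (π₁.symm x).1) π₁, G π) :
    ∑ π ∈ cyl I π₀, F π ≤ ∑ π ∈ cyl I π₀, G π := by
  let key : Equiv.Perm (K × Fin d) → K × (Fin d → K × Fin d) :=
    fun π => ((π.symm x).1, fun a => π ((π.symm x).1, a))
  have hmaps : ∀ π ∈ cyl I π₀, key π ∈ (cyl I π₀).image key := fun π hπ => mem_image_of_mem _ hπ
  rw [← sum_fiberwise_of_maps_to hmaps F, ← sum_fiberwise_of_maps_to hmaps G]
  refine sum_le_sum fun b hb => ?_
  obtain ⟨π₁, hπ₁, rfl⟩ := mem_image.1 hb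
  have hfib : {π ∈ cyl I π₀ | key π = key π₁} = cyl (I.erase (π₁.symm x).1) π₁ := by
    ext π
    simp only [mem_filter, mem_cyl, mem_erase, not_and]
    constructor
    · rintro ⟨h1, h2⟩ i hi a
      by_cases hie : i = (π₁.symm x).1
      · have h3 : (π.symm x).1 = (π₁.symm x).1 := congrArg (fun p => p.1) h2
        have h4 := congrFun (congrArg (fun p => p.2) h2) a
        simp only [key, h3] at h4
        rw [hie, h4]
      · rw [h1 i (hi hie), mem_cyl.1 hπ₁ i (hi hie)]
    · intro h1
      have h3 : (π.symm x) = (π₁.symm x) := by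
        rw [Equiv.symm_apply_eq]
        have := h1 (π₁.symm x).1 (fun h => absurd rfl h) (π₁.symm x).2
        simp only [Prod.mk.eta, Equiv.apply_symm_apply] at this
        exact this.symm
      refine ⟨fun i hi a => ?_, ?_⟩
      · rw [h1 i (fun _ => hi), mem_cyl.1 hπ₁ i hi]
      · simp only [key, h3]
        refine Prod.ext rfl ?_
        funext a
        exact h1 _ (fun h => absurd rfl h) a
  rw [hfib]
  exact h π₁ hπ₁

/-- The indicator that `π` places `x` and `y` in the same hyperedge. -/
def same (π : Equiv.Perm (K × Fin d)) (x y : K × Fin d) : ℝ :=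
  if (π.symm y).1 = (π.symm x).1 then 1 else 0

omit [Fintype K] in
lemma same_self (π : Equiv.Perm (K × Fin d)) (x : K × Fin d) : same π x x = 1 := by
  simp [same]

lemma sum_same {I : Finset K} {π₀ π : Equiv.Perm (K × Fin d)} (hπ : π ∈ cyl I π₀)
    {x : K × Fin d} (hx : x ∈ alive I π₀) : ∑ y ∈ alive I π₀, same π x y = d := by
  rw [← alive_of_mem_cyl hπ] at hx ⊢
  rw [alive_eq_map, sum_map, sum_product]
  simp only [same, Equiv.coe_toEmbedding, Equiv.symm_apply_apply, sum_const, card_univ,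
    Fintype.card_fin, nsmul_eq_mul, mul_ite, mul_one, mul_zero, sum_ite_eq',
    if_pos (mem_alive.1 hx)]

lemma swap_mul_mem_cyl {I : Finset K} {π₀ π : Equiv.Perm (K × Fin d)} {y z : K × Fin d}
    (hy : y ∈ alive I π₀) (hz : z ∈ alive I π₀) (hπ : π ∈ cyl I π₀) :
    Equiv.swap y z * π ∈ cyl I π₀ := by
  rw [mem_cyl] at *
  intro i hi a
  have hne : ∀ w ∈ alive I π₀, π₀ (i, a) ≠ w := by
    rintro w hw rfl
    rw [mem_alive] at hw
    simp only [Equiv.symm_apply_apply] at hw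
    exact hi hw
  rw [Equiv.Perm.mul_apply, hπ i hi a, Equiv.swap_apply_of_ne_of_ne (hne y hy) (hne z hz)]

lemma sum_cyl_swap {I : Finset K} {π₀ : Equiv.Perm (K × Fin d)} {y z : K × Fin d}
    (hy : y ∈ alive I π₀) (hz : z ∈ alive I π₀) (F : Equiv.Perm (K × Fin d) → ℝ) :
    ∑ π ∈ cyl I π₀, F (Equiv.swap y z * π) = ∑ π ∈ cyl I π₀, F π := by
  refine sum_bij (fun π _ => Equiv.swap y z * π) (fun π hπ => swap_mul_mem_cyl hy hz hπ)
    (fun π _ π' _ h => mul_left_cancel h) (fun π hπ => ⟨Equiv.swap y z * π,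
      swap_mul_mem_cyl hy hz hπ, ?_⟩) (fun π _ => rfl)
  rw [← mul_assoc, Equiv.swap_mul_self, one_mul]

omit [Fintype K] in
lemma same_swap (π : Equiv.Perm (K × Fin d)) {x y z : K × Fin d} (hxy : x ≠ y) (hxz : x ≠ z)
    (w : K × Fin d) : same (Equiv.swap y z * π) x w = same π x (Equiv.swap y z w) := by
  have h : ∀ w, (Equiv.swap y z * π).symm w = π.symm (Equiv.swap y z w) := by
    intro w
    rw [Equiv.symm_apply_eq, Equiv.Perm.mul_apply, Equiv.apply_symm_apply, Equiv.swap_apply_self]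
  simp only [same, h, Equiv.swap_apply_of_ne_of_ne hxy hxz]

lemma sum_cyl_same {I : Finset K} {π₀ : Equiv.Perm (K × Fin d)} {x y : K × Fin d}
    (hx : x ∈ alive I π₀) (hy : y ∈ alive I π₀) (hxy : y ≠ x) :
    ((#I * d : ℕ) - 1 : ℝ) * ∑ π ∈ cyl I π₀, same π x y = (d - 1) * #(cyl I π₀) := by
  have heq : ∀ z ∈ (alive I π₀).erase x, ∑ π ∈ cyl I π₀, same π x z =
      ∑ π ∈ cyl I π₀, same π x y := by
    intro z hz
    rw [mem_erase] at hz
    rw [← sum_cyl_swap hy hz.2]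
    refine sum_congr rfl fun π _ => ?_
    rw [same_swap π hxy.symm hz.1.symm, Equiv.swap_apply_right]
  have htot : ∑ z ∈ (alive I π₀).erase x, ∑ π ∈ cyl I π₀, same π x z =
      (d - 1) * #(cyl I π₀) := by
    rw [sum_comm, sum_congr rfl (g := fun _ => (d - 1 : ℝ))]
    · simp [mul_comm]; ring
    · intro π hπ
      have := sum_same hπ hx
      rw [← add_sum_erase _ _ hx, same_self] at this
      linarith
  rw [sum_congr rfl heq, sum_const, card_erase_of_mem hx, card_alive, nsmul_eq_mul,
    Nat.cast_sub, Nat.cast_one] at htot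
  · exact htot
  · rw [← card_alive I π₀]; exact card_pos.2 ⟨x, hx⟩

lemma sum_cyl_same_same {I : Finset K} {π₀ : Equiv.Perm (K × Fin d)} {x y y' : K × Fin d}
    (hx : x ∈ alive I π₀) (hy : y ∈ alive I π₀) (hy' : y' ∈ alive I π₀)
    (hxy : y ≠ x) (hxy' : y' ≠ x) (hyy' : y' ≠ y) :
    ((#I * d : ℕ) - 2 : ℝ) * ∑ π ∈ cyl I π₀, same π x y * same π x y' =
      (d - 2) * ∑ π ∈ cyl I π₀, same π x y := by
  have heq : ∀ z ∈ ((alive I π₀).erase x).erase y, ∑ π ∈ cyl I π₀, same π x y * same π x z =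
      ∑ π ∈ cyl I π₀, same π x y * same π x y' := by
    intro z hz
    simp only [mem_erase] at hz
    rw [← sum_cyl_swap hy' hz.2.2]
    refine sum_congr rfl fun π _ => ?_
    rw [same_swap π hxy'.symm hz.2.1.symm, same_swap π hxy'.symm hz.2.1.symm,
      Equiv.swap_apply_right, Equiv.swap_apply_of_ne_of_ne hyy'.symm hz.1.symm]
  have hy2 : y ∈ (alive I π₀).erase x := mem_erase.2 ⟨hxy, hy⟩
  have htot : ∑ z ∈ ((alive I π₀).erase x).erase y, ∑ π ∈ cyl I π₀, same π x y * same π x z =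
      (d - 2) * ∑ π ∈ cyl I π₀, same π x y := by
    rw [sum_comm, mul_sum]
    refine sum_congr rfl fun π hπ => ?_
    rw [← mul_sum]
    have := sum_same hπ hx
    rw [← add_sum_erase _ _ hx, ← add_sum_erase _ _ hy2, same_self] at this
    have h01 : same π x y = 0 ∨ same π x y = 1 := by unfold same; split_ifs <;> simp
    rcases h01 with h | h
    · simp [h]
    · rw [h] at this ⊢; linarith
  have hc : 2 ≤ #I * d := by
    rw [← card_alive I π₀]
    have := card_le_card (show {x, y} ⊆ alive I π₀ by
      intro w hw; simp only [mem_insert, mem_singleton] at hw; rcases hw with rfl | rfl <;> assumption)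
    rwa [card_pair hxy.symm] at this
  rw [sum_congr rfl heq, sum_const, card_erase_of_mem hy2, card_erase_of_mem hx, card_alive,
    nsmul_eq_mul, Nat.sub_sub, Nat.cast_sub hc] at htot
  push_cast at htot ⊢
  linarith

end Cylinder

end

section

open Finset

section Step

variable {K : Type*} [Fintype K] [DecidableEq K] {d : ℕ}

/-- The number of elements of `W` that `π` places in the same hyperedge as `x`. -/
def hits (W : Finset (K × Fin d)) (x : K × Fin d) (π : Equiv.Perm (K × Fin d)) : ℕ :=
  #{y ∈ W | (π.symm y).1 = (π.symm x).1}

omit [Fintype K] in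
lemma hits_eq_sum (W : Finset (K × Fin d)) (x : K × Fin d) (π : Equiv.Perm (K × Fin d)) :
    (hits W x π : ℝ) = ∑ y ∈ W, same π x y := by
  simp [hits, same]

lemma sum_hits {I : Finset K} {π₀ : Equiv.Perm (K × Fin d)} {x : K × Fin d}
    (hx : x ∈ alive I π₀) {W : Finset (K × Fin d)} (hW : W ⊆ (alive I π₀).erase x)
    (hn : 2 ≤ #I * d) :
    ∑ π ∈ cyl I π₀, (hits W x π : ℝ) =
      #W * ((d - 1) / ((#I * d : ℕ) - 1)) * #(cyl I π₀) := by
  have hn' : (0 : ℝ) < (#I * d : ℕ) - 1 := by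
    have : (2 : ℝ) ≤ (#I * d : ℕ) := by exact_mod_cast hn
    linarith
  simp only [hits_eq_sum]
  rw [sum_comm, sum_congr rfl (g := fun _ => (d - 1) / ((#I * d : ℕ) - 1) * (#(cyl I π₀) : ℝ))]
  · simp; ring
  · intro y hy
    have hy' := mem_erase.1 (hW hy)
    have := sum_cyl_same hx hy'.2 hy'.1
    field_simp
    linarith

lemma sum_hits_le {I : Finset K} {π₀ : Equiv.Perm (K × Fin d)} {x : K × Fin d}
    (hx : x ∈ alive I π₀) {W : Finset (K × Fin d)} (hW : W ⊆ (alive I π₀).erase x)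
    (hn : 2 ≤ #I * d) (hd : d ≤ #I * d) :
    ∑ π ∈ cyl I π₀, (hits W x π : ℝ) ≤ #W * (d / (#I * d : ℕ)) * #(cyl I π₀) := by
  rw [sum_hits hx hW hn]
  have hn' : (2 : ℝ) ≤ (#I * d : ℕ) := by exact_mod_cast hn
  have hd' : (d : ℝ) ≤ (#I * d : ℕ) := by exact_mod_cast hd
  gcongr ?_ * ?_ * ?_
  rw [div_le_div_iff₀ (by linarith) (by linarith)]
  nlinarith

lemma sum_hits_mul_le {I : Finset K} {π₀ : Equiv.Perm (K × Fin d)} {x : K × Fin d}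
    (hx : x ∈ alive I π₀) {W : Finset (K × Fin d)} (hW : W ⊆ (alive I π₀).erase x)
    (hn : 3 ≤ #I * d) (hd : d ≤ #I * d) :
    ∑ π ∈ cyl I π₀, (hits W x π : ℝ) * (hits W x π - 1) ≤
      (#W : ℝ) ^ 2 * (d / (#I * d : ℕ)) ^ 2 * #(cyl I π₀) := by
  have hn' : (3 : ℝ) ≤ (#I * d : ℕ) := by exact_mod_cast hn
  have hd' : (d : ℝ) ≤ (#I * d : ℕ) := by exact_mod_cast hd
  set q : ℝ := d / (#I * d : ℕ) with hq
  have hq0 : 0 ≤ q := by positivity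
  have hexp : ∀ π, (hits W x π : ℝ) * (hits W x π - 1) =
      ∑ y ∈ W, ∑ y' ∈ W.erase y, same π x y * same π x y' := by
    intro π
    have h01 : ∀ y, same π x y * same π x y = same π x y := by
      intro y; unfold same; split_ifs <;> simp
    rw [mul_sub, mul_one, hits_eq_sum, sum_mul_sum, ← sum_sub_distrib]
    refine sum_congr rfl fun y hy => ?_
    rw [← add_sum_erase _ _ hy, h01]
    ring
  simp only [hexp]
  have hpair : ∀ y ∈ W, ∀ y' ∈ W.erase y,
      ∑ π ∈ cyl I π₀, same π x y * same π x y' ≤ q * ∑ π ∈ cyl I π₀, same π x y := by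
    intro y hy y' hy'
    have h1 := mem_erase.1 (hW hy)
    have h2 := mem_erase.1 hy'
    have h3 := mem_erase.1 (hW h2.2)
    have := sum_cyl_same_same hx h1.2 h3.2 h1.1 h3.1 h2.1
    have hs : 0 ≤ ∑ π ∈ cyl I π₀, same π x y :=
      sum_nonneg fun π _ => by unfold same; split_ifs <;> simp
    have h4 : ∑ π ∈ cyl I π₀, same π x y * same π x y' =
        (d - 2) / ((#I * d : ℕ) - 2) * ∑ π ∈ cyl I π₀, same π x y := by
      rw [div_mul_eq_mul_div, eq_div_iff (by linarith), ← this]; ring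
    rw [h4]
    gcongr
    rw [hq, div_le_div_iff₀ (by linarith) (by linarith)]
    nlinarith
  have hsum : ∑ π ∈ cyl I π₀, ∑ y ∈ W, ∑ y' ∈ W.erase y, same π x y * same π x y' ≤
      ∑ y ∈ W, #W * (q * ∑ π ∈ cyl I π₀, same π x y) := by
    rw [sum_comm]
    refine sum_le_sum fun y hy => ?_
    rw [sum_comm]
    refine (sum_le_card_nsmul _ _ _ (hpair y hy)).trans ?_
    rw [nsmul_eq_mul]
    have hs : 0 ≤ ∑ π ∈ cyl I π₀, same π x y :=
      sum_nonneg fun π _ => by unfold same; split_ifs <;> simp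
    gcongr
    exact erase_subset _ _
  refine hsum.trans ?_
  rw [← mul_sum, ← mul_sum, sum_comm]
  simp only [← hits_eq_sum]
  have := sum_hits_le hx hW (by omega) hd
  calc (#W : ℝ) * (q * ∑ π ∈ cyl I π₀, (hits W x π : ℝ))
      ≤ #W * (q * (#W * q * #(cyl I π₀))) := by gcongr
    _ = _ := by ring

omit [Fintype K] in
lemma hits_le_card (W : Finset (K × Fin d)) (x : K × Fin d) (π : Equiv.Perm (K × Fin d)) :
    hits W x π ≤ #W := card_filter_le _ _

lemma abs_binE_sub_le {r r' B : ℝ} (h0 : 0 ≤ r) (h1 : r ≤ 1) (h0' : 0 ≤ r') (h1' : r' ≤ 1)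
    {u : ℕ → ℝ} (hu : ∀ i, |diff u i| ≤ B) {j e : ℕ} (he : e ≤ j) :
    |binE r' (j - e) u - binE r j u| ≤ B * e + B * |r' - r| * j := by
  obtain ⟨i, rfl⟩ := Nat.exists_eq_add_of_le' he
  rw [Nat.add_sub_cancel]
  have a1 := abs_binE_add_sub_le h0' h1' hu i e
  have a2 := abs_binE_sub_binE_le h0 h1 h0' h1' hu (i + e)
  rw [abs_le] at *
  constructor <;> linarith

lemma abs_binE_first_order_le {r r' B : ℝ} (h0 : 0 ≤ r) (h1 : r ≤ 1) (h0' : 0 ≤ r')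
    (h1' : r' ≤ 1) {u : ℕ → ℝ} (hu : ∀ i, |diff u i| ≤ B) {j e : ℕ} (he : e ≤ j) :
    |binE r' (j - e) u - binE r j u -
        ((r' - r) * j * binE r (j - 1) (diff u) - e * (r * binE r (j - 1) (diff u)))| ≤
      2 * B * (e * (e - 1)) + 2 * B * |r' - r| * j * e + B * (r' - r) ^ 2 * j ^ 2 := by
  have hB : 0 ≤ B := (abs_nonneg _).trans (hu 0)
  have t := abs_binE_taylor_le h0 h1 h0' h1' hu j
  rcases Nat.lt_or_ge e 2 with h | h
  · have : e = 0 ∨ e = 1 := by omega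
    rcases this with rfl | rfl
    · simpa using t
    · obtain ⟨i, rfl⟩ := Nat.exists_eq_add_of_le' he
      have s := binE_succ r i u
      have s' := binE_succ r' i u
      have a1 := abs_binE_sub_binE_le h0 h1 h0' h1' hu i
      have a2 := abs_binE_sub_binE_le h0 h1 h0' h1' hu (i + 1)
      simp only [Nat.add_sub_cancel] at t ⊢
      have hp : 0 ≤ B * |r' - r| := by positivity
      push_cast at *
      rw [abs_le] at *
      constructor <;> nlinarith
  · have he2 : (2 : ℝ) ≤ e := by exact_mod_cast h
    have w := abs_binE_le h0 h1 (j := j - 1) (fun i _ => hu i)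
    have a0 := abs_binE_sub_le h0 h1 h0 h1 hu he
    have a1 := abs_binE_sub_binE_le h0 h1 h0' h1' hu (j - e)
    have a2 := abs_binE_sub_binE_le h0 h1 h0' h1' hu j
    have hje : ((j - e : ℕ) : ℝ) ≤ j := by exact_mod_cast Nat.sub_le _ _
    have hrw : |e * (r * binE r (j - 1) (diff u))| ≤ e * B := by
      rw [abs_mul, abs_mul, abs_of_nonneg h0, Nat.abs_cast]
      have : r * |binE r (j - 1) (diff u)| ≤ 1 * B := by gcongr
      rw [one_mul] at this
      gcongr
    simp only [sub_self, abs_zero, mul_zero, zero_mul, add_zero] at a0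
    have hp : 0 ≤ B * |r' - r| := by positivity
    have b1 : B * |r' - r| * (j - e : ℕ) + B * |r' - r| * j ≤ 2 * B * |r' - r| * j * e := by
      have : (0 : ℝ) ≤ j := by positivity
      nlinarith [mul_nonneg hp this, mul_le_mul_of_nonneg_left hje hp]
    have b2 : 2 * (B * e) ≤ 2 * B * (e * (e - 1)) := by nlinarith [mul_nonneg hB (by linarith : (0 : ℝ) ≤ e)]
    rw [abs_le] at *
    constructor <;> linarith

lemma abs_sum_binE_sub_le {r r' B : ℝ} (h0 : 0 ≤ r) (h1 : r ≤ 1) (h0' : 0 ≤ r') (h1' : r' ≤ 1)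
    {u : ℕ → ℝ} (hu : ∀ i, |diff u i| ≤ B)
    {I : Finset K} {π₀ : Equiv.Perm (K × Fin d)} {x : K × Fin d}
    (hx : x ∈ alive I π₀) {W : Finset (K × Fin d)} (hW : W ⊆ (alive I π₀).erase x)
    (hn : 3 ≤ #I * d) (hd : d ≤ #I * d)
    (hr : |r' - r| ≤ 2 * (d / (#I * d : ℕ)))
    (hr' : |r' - r - r * ((d - 1) / ((#I * d : ℕ) - 1))| ≤ 2 * (d / (#I * d : ℕ)) ^ 2) :
    |∑ π ∈ cyl I π₀, (binE r' (#W - hits W x π) u - binE r (#W) u)| ≤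
      12 * B * (d / (#I * d : ℕ)) ^ 2 * (#W : ℝ) ^ 2 * #(cyl I π₀) := by
  have hB : 0 ≤ B := (abs_nonneg _).trans (hu 0)
  have s1 := sum_hits hx hW (by omega)
  have s2 := sum_hits_le hx hW (by omega) hd
  have s3 := sum_hits_mul_le hx hW hn hd
  have w := abs_binE_le h0 h1 (j := #W - 1) (fun i _ => hu i)
  set q : ℝ := d / (#I * d : ℕ) with hq
  set ω := binE r (#W - 1) (diff u)
  set N : ℝ := (#(cyl I π₀) : ℝ)
  set j : ℝ := (#W : ℝ)
  have hq0 : 0 ≤ q := by positivity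
  have hN0 : 0 ≤ N := by positivity
  have hj0 : 0 ≤ j := by positivity
  have hjj : j ≤ j ^ 2 := by
    have : #W ≤ #W ^ 2 := Nat.le_self_pow (by norm_num) _
    simp only [j]; exact_mod_cast this
  have hmain : |∑ π ∈ cyl I π₀, (binE r' (#W - hits W x π) u - binE r (#W) u) -
      ∑ π ∈ cyl I π₀, ((r' - r) * j * ω - hits W x π * (r * ω))| ≤
      ∑ π ∈ cyl I π₀, (2 * B * (hits W x π * (hits W x π - 1)) +
        2 * B * |r' - r| * j * hits W x π + B * (r' - r) ^ 2 * j ^ 2) := by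
    rw [← sum_sub_distrib]
    exact (abs_sum_le_sum_abs _ _).trans (sum_le_sum fun π _ =>
      abs_binE_first_order_le h0 h1 h0' h1' hu (hits_le_card W x π))
  have hlin : |∑ π ∈ cyl I π₀, ((r' - r) * j * ω - hits W x π * (r * ω))| ≤
      2 * B * q ^ 2 * j ^ 2 * N := by
    rw [sum_sub_distrib, sum_const, nsmul_eq_mul, ← sum_mul, s1]
    have : N * ((r' - r) * j * ω) - j * ((d - 1) / ((#I * d : ℕ) - 1)) * N * (r * ω) =
        (r' - r - r * ((d - 1) / ((#I * d : ℕ) - 1))) * ω * j * N := by ring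
    rw [this, abs_mul, abs_mul, abs_mul, abs_of_nonneg hj0, abs_of_nonneg hN0]
    calc _ ≤ 2 * q ^ 2 * B * j ^ 2 * N := by gcongr
      _ = _ := by ring
  have herr : ∑ π ∈ cyl I π₀, (2 * B * (hits W x π * (hits W x π - 1)) +
        2 * B * |r' - r| * j * hits W x π + B * (r' - r) ^ 2 * j ^ 2) ≤
      10 * B * q ^ 2 * j ^ 2 * N := by
    rw [sum_add_distrib, sum_add_distrib, ← mul_sum, ← mul_sum, sum_const, nsmul_eq_mul,
      ← sq_abs (r' - r)]
    calc _ ≤ 2 * B * (j ^ 2 * q ^ 2 * N) + 2 * B * (2 * q) * j * (j * q * N) +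
          N * (B * (2 * q) ^ 2 * j ^ 2) := by gcongr
      _ = _ := by ring
  have := hmain.trans herr
  rw [abs_le] at *
  constructor <;> linarith

variable {V : Type*} [Fintype V] [DecidableEq V]

/-- The sum over all vertices of the thinned value of `u` at their degrees. -/
noncomputable def potential (g : K × Fin d → V) (u : ℕ → ℝ) (r : ℝ) (S : Finset (K × Fin d)) : ℝ :=
  ∑ v, binE r (degIn g S v) u

omit [Fintype V] in
lemma degIn_alive_erase (g : K × Fin d → V) {I : Finset K} {π₀ π : Equiv.Perm (K × Fin d)}
    (hπ : π ∈ cyl I π₀) (x : K × Fin d) (v : V) :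
    degIn g (alive (I.erase (π.symm x).1) π) v =
      degIn g (alive I π₀) v - hits {y ∈ alive I π₀ | g y = v} x π := by
  rw [← alive_of_mem_cyl hπ]
  have h : ({y ∈ alive (I.erase (π.symm x).1) π | g y = v} : Finset _) =
      {y ∈ alive I π | g y = v} \ {y ∈ alive I π | g y = v ∧ (π.symm y).1 = (π.symm x).1} := by
    ext y
    simp only [mem_filter, mem_alive, mem_erase, mem_sdiff]
    tauto
  unfold degIn hits
  rw [h, card_sdiff_of_subset, filter_filter]
  intro y
  simp only [mem_filter]
  tauto

omit [Fintype K] [DecidableEq K] in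
lemma sum_degIn (g : K × Fin d → V) (S : Finset (K × Fin d)) : ∑ v, degIn g S v = #S :=
  (card_eq_sum_card_fiberwise (fun y _ => mem_univ (g y))).symm

lemma potential_step {l : ℕ} {r r' B : ℝ} (h0 : 0 ≤ r) (h1 : r ≤ 1) (h0' : 0 ≤ r') (h1' : r' ≤ 1)
    {u : ℕ → ℝ} (hu : ∀ i, |diff u i| ≤ B) (hul : ∀ i < l, u i = 0) (g : K × Fin d → V) (z : ℝ)
    {I : Finset K} {π₀ : Equiv.Perm (K × Fin d)} {x : K × Fin d}
    (hx : x ∈ alive I π₀) (hlight : degIn g (alive I π₀) (g x) < l)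
    (hn : 3 ≤ #I * d) (hd : d ≤ #I * d)
    (hr : |r' - r| ≤ 2 * (d / (#I * d : ℕ)))
    (hr' : |r' - r - r * ((d - 1) / ((#I * d : ℕ) - 1))| ≤ 2 * (d / (#I * d : ℕ)) ^ 2) :
    ∑ π ∈ cyl I π₀, (potential g u r' (alive (I.erase (π.symm x).1) π) - z) ^ 2 ≤
      #(cyl I π₀) * ((potential g u r (alive I π₀) - z) ^ 2 +
        2 * |potential g u r (alive I π₀) - z| *
          (12 * B * (d / (#I * d : ℕ)) ^ 2 * ∑ v, (degIn g univ v : ℝ) ^ 2) + (3 * B * d) ^ 2) := by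
  have hB : 0 ≤ B := (abs_nonneg _).trans (hu 0)
  set S := alive I π₀ with hS
  let W : V → Finset (K × Fin d) := fun v => {y ∈ S | g y = v}
  have hWdeg : ∀ v, degIn g S v = #(W v) := fun v => rfl
  set q : ℝ := d / (#I * d : ℕ) with hq
  set N : ℝ := (#(cyl I π₀) : ℝ)
  have hq0 : 0 ≤ q := by positivity
  have hN0 : 0 ≤ N := by positivity
  set Z := potential g u r S with hZ
  let X : V → Equiv.Perm (K × Fin d) → ℝ :=
    fun v π => binE r' (#(W v) - hits (W v) x π) u - binE r #(W v) u
  have hdelta : ∀ π ∈ cyl I π₀,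
      potential g u r' (alive (I.erase (π.symm x).1) π) = Z + ∑ v, X v π := by
    intro π hπ
    simp only [X, sum_sub_distrib, hZ, potential, hWdeg]
    rw [add_sub_cancel]
    refine sum_congr rfl fun v _ => ?_
    rw [degIn_alive_erase g hπ]
    rfl
  have hX : ∀ v, |∑ π ∈ cyl I π₀, X v π| ≤ 12 * B * q ^ 2 * (#(W v) : ℝ) ^ 2 * N := by
    intro v
    by_cases hv : g x = v
    · have : ∀ π, X v π = 0 := by
        intro π
        subst hv
        simp only [X]
        rw [hWdeg] at hlight
        rw [binE_eq_zero, binE_eq_zero, sub_self]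
        · intro i hi; exact hul i (by omega)
        · intro i hi; exact hul i (by omega)
      simp only [this, sum_const_zero, abs_zero]
      positivity
    · refine abs_sum_binE_sub_le h0 h1 h0' h1' hu hx ?_ hn hd hr hr'
      intro y hy
      simp only [W, mem_filter] at hy
      refine mem_erase.2 ⟨?_, hy.1⟩
      rintro rfl
      exact hv hy.2
  have hsum : |∑ π ∈ cyl I π₀, ∑ v, X v π| ≤
      N * (12 * B * q ^ 2 * ∑ v, (degIn g univ v : ℝ) ^ 2) := by
    rw [sum_comm]
    refine (abs_sum_le_sum_abs _ _).trans ((sum_le_sum fun v _ => hX v).trans ?_)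
    rw [← sum_mul, ← mul_sum, mul_comm]
    gcongr with v
    exact card_le_card (filter_subset_filter _ (subset_univ _))
  have habs : ∀ π ∈ cyl I π₀, |∑ v, X v π| ≤ 3 * B * d := by
    intro π hπ
    have hXa : ∀ v, |X v π| ≤ B * hits (W v) x π + B * |r' - r| * #(W v) := fun v =>
      abs_binE_sub_le h0 h1 h0' h1' hu (hits_le_card _ x π)
    have hhits : ∑ v, (hits (W v) x π : ℝ) = d := by
      rw [← sum_same hπ hx]
      simp only [hits_eq_sum, W]
      exact sum_fiberwise S g _
    have hcard : ∑ v, (#(W v) : ℝ) = (#I * d : ℕ) := by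
      rw [← card_alive I π₀, ← sum_degIn g (alive I π₀)]
      push_cast
      rfl
    refine (abs_sum_le_sum_abs _ _).trans ((sum_le_sum fun v _ => hXa v).trans ?_)
    rw [sum_add_distrib, ← mul_sum, ← mul_sum, hhits, hcard]
    have hn0 : (0 : ℝ) < (#I * d : ℕ) := by
      have : 0 < #I * d := by omega
      exact_mod_cast this
    calc B * d + B * |r' - r| * (#I * d : ℕ) ≤ B * d + B * (2 * q) * (#I * d : ℕ) := by gcongr
      _ = 3 * B * d := by rw [hq]; field_simp; ring
  have hexp : ∀ π ∈ cyl I π₀, (potential g u r' (alive (I.erase (π.symm x).1) π) - z) ^ 2 ≤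
      (Z - z) ^ 2 + 2 * (Z - z) * ∑ v, X v π + (3 * B * d) ^ 2 := by
    intro π hπ
    rw [hdelta π hπ]
    have h2 : (∑ v, X v π) ^ 2 ≤ (3 * B * d) ^ 2 := by
      rw [← sq_abs]
      have := habs π hπ
      gcongr
    nlinarith
  refine (sum_le_sum hexp).trans ?_
  rw [sum_add_distrib, sum_add_distrib, ← mul_sum, sum_const, sum_const, nsmul_eq_mul, nsmul_eq_mul]
  have h3 : (Z - z) * ∑ π ∈ cyl I π₀, ∑ v, X v π ≤
      |Z - z| * (N * (12 * B * q ^ 2 * ∑ v, (degIn g univ v : ℝ) ^ 2)) := by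
    refine (le_abs_self _).trans ?_
    rw [abs_mul]
    gcongr
  nlinarith

end Step

end

section

open Finset

section Explore

variable {K : Type*} [Fintype K] [DecidableEq K] {d : ℕ} {V : Type*} [DecidableEq V]

/-- The hyperedges in `T` form an `l`-core: every vertex they cover is covered at least `l`
times. -/
def IsCore (l : ℕ) (f : K × Fin d → V) (T : Finset K) : Prop :=
  ∀ v, degIn f (T ×ˢ univ) v ≠ 0 → l ≤ degIn f (T ×ˢ univ) v

lemma degIn_comp_perm (g : K × Fin d → V) (π : Equiv.Perm (K × Fin d)) (T : Finset K) (v : V) :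
    degIn (g ∘ π) (T ×ˢ univ) v = degIn g (alive T π) v := by
  rw [alive_eq_map]
  unfold degIn
  rw [filter_map, card_map]
  rfl

omit [Fintype K] [DecidableEq K] in
lemma degIn_mono {ι : Type*} (g : ι → V) {S S' : Finset ι} (h : S ⊆ S') (v : V) :
    degIn g S v ≤ degIn g S' v :=
  card_le_card (filter_subset_filter _ h)

lemma alive_mono {I J : Finset K} (h : I ⊆ J) (π : Equiv.Perm (K × Fin d)) :
    alive I π ⊆ alive J π := fun _ hy => mem_alive.2 (h (mem_alive.1 hy))

lemma degIn_pos_of_mem {ι : Type*} (g : ι → V) {S : Finset ι} {y : ι} (hy : y ∈ S) :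
    degIn g S (g y) ≠ 0 :=
  card_ne_zero_of_mem (mem_filter.2 ⟨hy, rfl⟩)

lemma symm_fst_notMem_of_isCore {l : ℕ} {g : K × Fin d → V} {π : Equiv.Perm (K × Fin d)}
    {I T : Finset K} {x : K × Fin d} (hT : IsCore l (g ∘ π) T) (hTI : T ⊆ I)
    (hlight : degIn g (alive I π) (g x) < l) : (π.symm x).1 ∉ T := by
  intro hx
  have h1 := hT (g x)
  rw [degIn_comp_perm] at h1
  have h2 := h1 (degIn_pos_of_mem g (mem_alive.2 hx))
  have h3 := degIn_mono g (alive_mono hTI π) (g x)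
  omega

lemma isCore_of_forall_le {l : ℕ} {g : K × Fin d → V} {π : Equiv.Perm (K × Fin d)}
    {I : Finset K} (h : ∀ x ∈ alive I π, l ≤ degIn g (alive I π) (g x)) :
    IsCore l (g ∘ π) I := by
  intro v hv
  rw [degIn_comp_perm] at hv ⊢
  obtain ⟨y, hy⟩ := card_ne_zero.1 hv
  rw [mem_filter] at hy
  exact hy.2 ▸ h y hy.1

variable [Fintype V]

omit [DecidableEq K] in
lemma abs_potential_sub_le {r : ℝ} (h0 : 0 ≤ r) (h1 : r ≤ 1) {u : ℕ → ℝ} (hu0 : ∀ i, 0 ≤ u i)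
    (hu1 : ∀ i, u i ≤ i) (g : K × Fin d → V) (S : Finset (K × Fin d)) (z : ℝ) :
    |potential g u r S - z| ≤ Fintype.card K * d + |z| := by
  have hp0 : 0 ≤ potential g u r S := by
    refine sum_nonneg fun v _ => ?_
    have := binE_mono h0 h1 (j := degIn g S v) (u := fun _ => 0) (v := u) (fun i _ => hu0 i)
    rwa [binE_eq_zero r (fun _ _ => rfl)] at this
  have hp1 : potential g u r S ≤ Fintype.card K * d := by
    calc potential g u r S ≤ ∑ v, (degIn g S v : ℝ) := by
          refine sum_le_sum fun v _ => (le_abs_self _).trans (abs_binE_le h0 h1 fun i hi => ?_)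
          rw [abs_of_nonneg (hu0 i)]
          exact (hu1 i).trans (by exact_mod_cast hi)
      _ = #S := by rw [← sum_degIn g S]; push_cast; rfl
      _ ≤ Fintype.card (K × Fin d) := by exact_mod_cast card_le_univ S
      _ = _ := by simp
  calc |potential g u r S - z| ≤ |potential g u r S| + |z| := abs_sub _ _
    _ ≤ _ := by rw [abs_of_nonneg hp0]; gcongr

/-- Peeling hyperedges off a random hypergraph until `k₀` hyperedges remain, a bad event that is
incompatible with stopping early and with a potential close to `z` has small probability. -/
theorem sq_mul_card_bad_le {l : ℕ} {B z G : ℝ} {k₀ : ℕ} {rho : ℕ → ℝ} {u : ℕ → ℝ}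
    (hd : 2 ≤ d) (hk₀ : 1 ≤ k₀) (hG : 0 ≤ G)
    (hrho0 : ∀ i, 0 ≤ rho i) (hrho1 : ∀ i, k₀ ≤ i → rho i ≤ 1) (hrhok : rho k₀ = 1)
    (hr : ∀ i, k₀ < i → |rho (i - 1) - rho i| ≤ 2 * (d / (i * d : ℕ)))
    (hr' : ∀ i, k₀ < i → |rho (i - 1) - rho i - rho i * ((d - 1) / ((i * d : ℕ) - 1))| ≤
      2 * (d / (i * d : ℕ)) ^ 2)
    (hu : ∀ i, |diff u i| ≤ B) (hul : ∀ i < l, u i = 0) (hu0 : ∀ i, 0 ≤ u i) (hu1 : ∀ i, u i ≤ i)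
    (Bad : (K × Fin d → V) → Prop) [DecidablePred Bad]
    (h1 : ∀ f (I : Finset K), k₀ < #I → IsCore l f I → ¬ Bad f)
    (h2 : ∀ f (I : Finset K), #I = k₀ → (∀ T, IsCore l f T → T ⊆ I) →
      |∑ v, u (degIn f (I ×ˢ univ) v) - z| < G → ¬ Bad f)
    (g : K × Fin d → V) (I : Finset K) (π₀ : Equiv.Perm (K × Fin d)) (hI : k₀ ≤ #I)
    (hcore : ∀ π ∈ cyl I π₀, ∀ T, IsCore l (g ∘ π) T → T ⊆ I) :
    G ^ 2 * #((cyl I π₀).filter fun π : Equiv.Perm (K × Fin d) => Bad (g ∘ π)) ≤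
      #(cyl I π₀) * ((potential g u (rho #I) (alive I π₀) - z) ^ 2 +
        (2 * (Fintype.card K * d + |z|) *
          (12 * B * (1 / k₀) ^ 2 * ∑ v, (degIn g univ v : ℝ) ^ 2) + (3 * B * d) ^ 2) *
          (#I - k₀)) := by
  have hB : 0 ≤ B := (abs_nonneg _).trans (hu 0)
  set A : ℝ := 2 * (Fintype.card K * d + |z|) *
    (12 * B * (1 / k₀) ^ 2 * ∑ v, (degIn g univ v : ℝ) ^ 2) + (3 * B * d) ^ 2 with hA
  have hA0 : 0 ≤ A := by positivity
  obtain ⟨j, hj⟩ := Nat.exists_eq_add_of_le hI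
  induction j generalizing I π₀ with
  | zero =>
    rw [add_zero] at hj
    rw [hj, sub_self, mul_zero, add_zero, hrhok, mul_comm]
    have hpot : potential g u 1 (alive I π₀) = ∑ v, u (degIn (g ∘ π₀) (I ×ˢ univ) v) := by
      simp only [potential, binE_one, degIn_comp_perm]
    have hpot' : ∀ π ∈ cyl I π₀, ∑ v, u (degIn (g ∘ π) (I ×ˢ univ) v) =
        potential g u 1 (alive I π₀) := by
      intro π hπ
      rw [hpot]
      simp only [degIn_comp_perm, alive_of_mem_cyl hπ]
    by_cases hlt : |potential g u 1 (alive I π₀) - z| < G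
    · have : (cyl I π₀).filter (fun π : Equiv.Perm (K × Fin d) => Bad (g ∘ π)) = ∅ := by
        refine filter_eq_empty_iff.2 fun π hπ => h2 _ I hj (hcore π hπ) ?_
        rwa [hpot' π hπ]
      rw [this, card_empty, Nat.cast_zero, zero_mul]
      positivity
    · rw [← sq_abs (potential g u 1 (alive I π₀) - z)]
      push Not at hlt
      have : #((cyl I π₀).filter fun π : Equiv.Perm (K × Fin d) => Bad (g ∘ π)) ≤ #(cyl I π₀) := card_filter_le _ _
      gcongr
  | succ j ih =>
    by_cases hlight : ∃ x ∈ alive I π₀, degIn g (alive I π₀) (g x) < l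
    · obtain ⟨x, hx, hxl⟩ := hlight
      have hi2 : 2 ≤ #I := by omega
      have hn : 3 ≤ #I * d := by nlinarith
      have hdn : d ≤ #I * d := by nlinarith
      have hIk : k₀ < #I := by omega
      have step := potential_step (l := l) (hrho0 #I) (hrho1 _ hI) (hrho0 (#I - 1))
        (hrho1 _ (by omega)) hu hul g z hx hxl hn hdn (hr _ hIk) (hr' _ hIk)
      have hq : (d : ℝ) / (#I * d : ℕ) ≤ 1 / k₀ := by
        have hd0 : (0 : ℝ) < d := by exact_mod_cast (by omega : 0 < d)
        have hk0 : (0 : ℝ) < k₀ := by exact_mod_cast hk₀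
        have hk1 : (k₀ : ℝ) ≤ #I := by exact_mod_cast hI
        rw [div_le_div_iff₀ (by push_cast; nlinarith) hk0]
        push_cast
        nlinarith
      have hD := abs_potential_sub_le (hrho0 #I) (hrho1 _ hI) hu0 hu1 g (alive I π₀) z
      have hAle : 2 * |potential g u (rho #I) (alive I π₀) - z| *
          (12 * B * (d / (#I * d : ℕ)) ^ 2 * ∑ v, (degIn g univ v : ℝ) ^ 2) + (3 * B * d) ^ 2 ≤
          A := by
        rw [hA]; gcongr
      have key : ∑ π ∈ cyl I π₀, G ^ 2 * (if Bad (g ∘ π) then 1 else 0) ≤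
          ∑ π ∈ cyl I π₀, ((potential g u (rho (#I - 1)) (alive (I.erase (π.symm x).1) π) - z) ^ 2 +
            A * (#I - 1 - k₀)) := by
        refine sum_cyl_le x fun π₁ hπ₁ => ?_
        set e := (π₁.symm x).1 with he
        have heI : e ∈ I := by
          have := alive_of_mem_cyl hπ₁ ▸ hx
          exact mem_alive.1 this
        have hsub : ∀ π ∈ cyl (I.erase e) π₁, π ∈ cyl I π₀ := by
          intro π hπ
          rw [mem_cyl] at hπ hπ₁ ⊢
          intro i hi a
          rw [hπ i (fun h => hi (mem_of_mem_erase h)), hπ₁ i hi]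
        have hrow : ∀ π ∈ cyl (I.erase e) π₁, π.symm x = π₁.symm x := by
          intro π hπ
          refine symm_apply_of_mem_cyl hπ fun h => ?_
          rw [mem_alive] at h
          exact notMem_erase _ _ h
        have hc : #(I.erase e) = #I - 1 := card_erase_of_mem heI
        have hih := ih (I.erase e) π₁ (by omega) (fun π hπ T hT => by
            have hTI := hcore π (hsub π hπ) T hT
            refine subset_erase.2 ⟨hTI, ?_⟩
            rw [he, ← hrow π hπ]
            refine symm_fst_notMem_of_isCore hT hTI ?_
            rwa [alive_of_mem_cyl (hsub π hπ)]) (by omega)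
        have hL : ∑ π ∈ cyl (I.erase e) π₁, G ^ 2 * (if Bad (g ∘ π) then (1 : ℝ) else 0) =
            G ^ 2 * #((cyl (I.erase e) π₁).filter fun π : Equiv.Perm (K × Fin d) => Bad (g ∘ π)) := by
          rw [← mul_sum, card_filter]; push_cast; rfl
        rw [hL, sum_congr rfl (g := fun _ => (potential g u (rho #(I.erase e))
          (alive (I.erase e) π₁) - z) ^ 2 + A * (#(I.erase e) - k₀))]
        · rw [sum_const, nsmul_eq_mul]
          exact hih
        · intro π hπ
          rw [hrow π hπ, ← he, alive_of_mem_cyl hπ, hc, Nat.cast_sub (by omega), Nat.cast_one]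
      rw [← mul_sum, sum_add_distrib, sum_const, nsmul_eq_mul] at key
      rw [card_filter]
      push_cast
      refine key.trans ((add_le_add_left step _).trans ?_)
      have hc0 : (0 : ℝ) ≤ #(cyl I π₀) := Nat.cast_nonneg _
      nlinarith [mul_le_mul_of_nonneg_left hAle hc0]
    · push Not at hlight
      have : (cyl I π₀).filter (fun π : Equiv.Perm (K × Fin d) => Bad (g ∘ π)) = ∅ := by
        refine filter_eq_empty_iff.2 fun π hπ => h1 _ I (by omega) ?_
        refine isCore_of_forall_le ?_
        rwa [alive_of_mem_cyl hπ]
      rw [this, card_empty, Nat.cast_zero, mul_zero]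
      have : (k₀ : ℝ) ≤ #I := by exact_mod_cast hI
      have : (0 : ℝ) ≤ #I - k₀ := by linarith
      positivity

end Explore

end

section

open Finset

section Moments

variable {ι V : Type*} [Fintype ι] [DecidableEq ι] [Fintype V] [DecidableEq V]

lemma abs_sum_degIn_sub_erase_le {B : ℝ} {h : ℕ → ℝ} (hh : ∀ j, |h (j + 1) - h j| ≤ B)
    (f : ι → V) (i : ι) :
    |∑ v, h (degIn f univ v) - ∑ v, h (degIn f (univ.erase i) v)| ≤ B := by
  have hdeg : ∀ v, degIn f univ v = degIn f (univ.erase i) v + if f i = v then 1 else 0 := by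
    intro v
    simp only [degIn, card_filter]
    rw [← sum_erase_add _ _ (mem_univ i)]
  rw [← sum_sub_distrib, sum_eq_single (f i)]
  · rw [hdeg, if_pos rfl]
    exact hh _
  · intro v _ hv
    rw [hdeg, if_neg (Ne.symm hv), add_zero, sub_self]
  · simp

lemma sum_sq_sum_degIn_sub_le [Nonempty V] {B : ℝ} {h : ℕ → ℝ}
    (hh : ∀ j, |h (j + 1) - h j| ≤ B) :
    ∑ f : ι → V, (∑ v, h (degIn f univ v) -
        (∑ f' : ι → V, ∑ v, h (degIn f' univ v)) / (Fintype.card V : ℝ) ^ Fintype.card ι) ^ 2 ≤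
      Fintype.card ι * (2 * B) ^ 2 * (Fintype.card V : ℝ) ^ Fintype.card ι := by
  refine variance_le _ fun i f f' hff' => ?_
  have e : ∀ v, degIn f (univ.erase i) v = degIn f' (univ.erase i) v := by
    intro v
    unfold degIn
    congr 1
    refine filter_congr fun j hj => ?_
    rw [hff' j (ne_of_mem_erase hj)]
  have a1 := abs_sum_degIn_sub_erase_le hh f i
  have a2 := abs_sum_degIn_sub_erase_le hh f' i
  simp only [e] at a1
  rw [abs_le] at *
  constructor <;> linarith

lemma sum_sum_binE_degIn (r : ℝ) (u : ℕ → ℝ) :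
    ∑ f : ι → V, ∑ v, binE r (degIn f univ v) u =
      (Fintype.card V : ℝ) ^ Fintype.card ι *
        (Fintype.card V * binE (r / Fintype.card V) (Fintype.card ι) u) := by
  rw [sum_comm]
  simp only [sum_binE_degIn]
  rw [sum_const, card_univ, nsmul_eq_mul]
  ring

lemma sum_sum_degIn_mul_pred_le [Nonempty V] :
    ∑ f : ι → V, ∑ v, ((degIn f univ v : ℝ) * (degIn f univ v - 1)) ≤
      (Fintype.card V : ℝ) ^ Fintype.card ι *
        ((Fintype.card ι : ℝ) ^ 2 / Fintype.card V) := by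
  have hV : (0 : ℝ) < Fintype.card V := by exact_mod_cast Fintype.card_pos
  have h2 : ∀ j : ℕ, (j : ℝ) * (j - 1) = 2 * binE 1 j (fun i => (i.choose 2 : ℝ)) := by
    intro j
    rw [binE_one, Nat.cast_choose_two]
    ring
  simp only [h2, ← mul_sum]
  rw [sum_sum_binE_degIn, binE_choose, Nat.cast_choose_two]
  have hN : (0 : ℝ) ≤ Fintype.card ι := Nat.cast_nonneg _
  have hP : (0 : ℝ) < (Fintype.card V : ℝ) ^ Fintype.card ι := by positivity
  calc _ = (Fintype.card V : ℝ) ^ Fintype.card ι *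
        ((Fintype.card ι : ℝ) * (Fintype.card ι - 1) / Fintype.card V) := by
        field_simp
    _ ≤ _ := by gcongr; nlinarith

lemma sum_sum_degIn_sq_le [Nonempty V] :
    ∑ f : ι → V, ∑ v, (degIn f univ v : ℝ) ^ 2 ≤
      (Fintype.card V : ℝ) ^ Fintype.card ι *
        ((Fintype.card ι : ℝ) ^ 2 / Fintype.card V + Fintype.card ι) := by
  have h := sum_sum_degIn_mul_pred_le (ι := ι) (V := V)
  have h1 : ∀ f : ι → V, ∑ v, (degIn f univ v : ℝ) ^ 2 =
      ∑ v, ((degIn f univ v : ℝ) * (degIn f univ v - 1)) + Fintype.card ι := by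
    intro f
    have : ∑ v, degIn f univ v = Fintype.card ι :=
      (card_eq_sum_card_fiberwise (fun y _ => mem_univ (f y))).symm
    rw [← this]
    push_cast
    rw [← sum_add_distrib]
    exact sum_congr rfl fun _ _ => by ring
  simp only [h1]
  rw [sum_add_distrib, sum_const, card_univ, nsmul_eq_mul, Fintype.card_fun]
  push_cast
  linarith

end Moments

section Bad

variable {K : Type*} [Fintype K] [DecidableEq K] {d : ℕ} {V : Type*} [Fintype V] [DecidableEq V]

lemma card_perm_mul_card_filter {α V : Type*} [Fintype α] [DecidableEq α] [Fintype V]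
    [DecidableEq V] (Bad : (α → V) → Prop) [DecidablePred Bad] :
    #(univ : Finset (Equiv.Perm α)) * #{f : α → V | Bad f} =
      ∑ g : α → V, #(univ.filter fun π : Equiv.Perm α => Bad (g ∘ π)) := by
  simp only [card_filter]
  rw [sum_comm, ← smul_eq_mul, ← sum_const]
  refine sum_congr rfl fun π _ => ?_
  exact (Fintype.sum_equiv (π.arrowCongr (Equiv.refl V)) _ _ (fun f => by
    congr 2; ext x; simp))

theorem sq_mul_card_filter_le {l : ℕ} {B z G : ℝ} {k₀ : ℕ} {rho : ℕ → ℝ} {u : ℕ → ℝ}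
    [Nonempty V] (hd : 2 ≤ d) (hk₀ : 1 ≤ k₀) (hk : k₀ ≤ Fintype.card K) (hG : 0 ≤ G)
    (hrho0 : ∀ i, 0 ≤ rho i) (hrho1 : ∀ i, k₀ ≤ i → rho i ≤ 1) (hrhok : rho k₀ = 1)
    (hr : ∀ i, k₀ < i → |rho (i - 1) - rho i| ≤ 2 * (d / (i * d : ℕ)))
    (hr' : ∀ i, k₀ < i → |rho (i - 1) - rho i - rho i * ((d - 1) / ((i * d : ℕ) - 1))| ≤
      2 * (d / (i * d : ℕ)) ^ 2)
    (hu : ∀ i, |diff u i| ≤ B) (hul : ∀ i < l, u i = 0) (hu0 : ∀ i, 0 ≤ u i) (hu1 : ∀ i, u i ≤ i)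
    (Bad : (K × Fin d → V) → Prop) [DecidablePred Bad]
    (h1 : ∀ f (I : Finset K), k₀ < #I → IsCore l f I → ¬ Bad f)
    (h2 : ∀ f (I : Finset K), #I = k₀ → (∀ T, IsCore l f T → T ⊆ I) →
      |∑ v, u (degIn f (I ×ˢ univ) v) - z| < G → ¬ Bad f) :
    G ^ 2 * (#{f : K × Fin d → V | Bad f} : ℝ) ≤
      (Fintype.card V : ℝ) ^ (Fintype.card K * d) *
        (8 * (Fintype.card K * d) * B ^ 2 +
          2 * (Fintype.card V * binE (rho (Fintype.card K) / Fintype.card V)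
            (Fintype.card K * d) u - z) ^ 2 +
        (2 * (Fintype.card K * d + |z|) * (12 * B * (1 / k₀) ^ 2 *
          ((Fintype.card K * d : ℝ) ^ 2 / Fintype.card V + Fintype.card K * d)) +
            (3 * B * d) ^ 2) * Fintype.card K) := by
  have hB : 0 ≤ B := (abs_nonneg _).trans (hu 0)
  have hV : (0 : ℝ) < Fintype.card V := by exact_mod_cast Fintype.card_pos
  set k := Fintype.card K with hkdef
  set m : ℝ := (Fintype.card V : ℝ)
  have hcι : Fintype.card (K × Fin d) = k * d := by simp [hkdef]
  set P : ℝ := (#(univ : Finset (Equiv.Perm (K × Fin d))) : ℝ) with hP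
  have hP0 : 0 < P := by rw [hP]; exact_mod_cast card_pos.2 univ_nonempty
  have hexp : ∀ g : K × Fin d → V,
      G ^ 2 * #(univ.filter fun π : Equiv.Perm (K × Fin d) => Bad (g ∘ π)) ≤
      P * ((potential g u (rho k) univ - z) ^ 2 +
        (2 * (k * d + |z|) *
          (12 * B * (1 / k₀) ^ 2 * ∑ v, (degIn g univ v : ℝ) ^ 2) + (3 * B * d) ^ 2) * k) := by
    intro g
    have h := sq_mul_card_bad_le hd hk₀ hG hrho0 hrho1 hrhok hr hr' hu hul hu0 hu1 Bad h1 h2 g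
      univ 1 (by rwa [card_univ]) (fun _ _ T _ => subset_univ T)
    rw [cyl_univ, alive_univ, (card_univ : #(univ : Finset K) = k)] at h
    refine h.trans (mul_le_mul_of_nonneg_left ?_ hP0.le)
    gcongr
    have : (0 : ℝ) ≤ k₀ := Nat.cast_nonneg _
    linarith
  have hsum : P * (G ^ 2 * #{f : K × Fin d → V | Bad f}) ≤
      P * ∑ g : K × Fin d → V, ((potential g u (rho k) univ - z) ^ 2 +
        (2 * (k * d + |z|) *
          (12 * B * (1 / k₀) ^ 2 * ∑ v, (degIn g univ v : ℝ) ^ 2) + (3 * B * d) ^ 2) * k) := by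
    have hc : P * (#{f : K × Fin d → V | Bad f} : ℝ) = ∑ g : K × Fin d → V,
        (#(univ.filter fun π : Equiv.Perm (K × Fin d) => Bad (g ∘ π)) : ℝ) := by
      rw [hP]; exact_mod_cast card_perm_mul_card_filter Bad
    rw [mul_left_comm, hc, mul_sum, mul_sum]
    exact sum_le_sum fun g _ => hexp g
  refine (le_of_mul_le_mul_left hsum hP0).trans ?_
  set μ := m * binE (rho k / m) (k * d) u with hμ
  set M : ℝ := m ^ (k * d) with hM
  have hM0 : 0 < M := by positivity
  have hmean : (∑ g : K × Fin d → V, potential g u (rho k) univ) = M * μ := by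
    have := sum_sum_binE_degIn (ι := K × Fin d) (V := V) (rho k) u
    rwa [hcι] at this
  have hstep : ∀ j, |binE (rho k) (j + 1) u - binE (rho k) j u| ≤ B := by
    intro j
    simpa using abs_binE_add_sub_le (hrho0 k) (hrho1 k hk) hu j 1
  have hvar := sum_sq_sum_degIn_sub_le (ι := K × Fin d) (V := V)
    (h := fun j => binE (rho k) j u) hstep
  have hmean' : (∑ g : K × Fin d → V, ∑ v, binE (rho k) (degIn g univ v) u) = M * μ := hmean
  rw [hmean', hcι, mul_div_cancel_left₀ _ hM0.ne'] at hvar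
  have hvar2 : ∑ g : K × Fin d → V, (potential g u (rho k) univ - z) ^ 2 ≤
      M * (8 * (k * d) * B ^ 2 + 2 * (μ - z) ^ 2) := by
    calc _ ≤ ∑ g : K × Fin d → V, (2 * (potential g u (rho k) univ - μ) ^ 2 + 2 * (μ - z) ^ 2) :=
          sum_le_sum fun g _ => by
            nlinarith [sq_nonneg (potential g u (rho k) univ - μ - (μ - z))]
      _ ≤ _ := by
          rw [sum_add_distrib, ← mul_sum, sum_const, card_univ, Fintype.card_fun, hcι, nsmul_eq_mul]
          push_cast at hvar ⊢
          have := mul_le_mul_of_nonneg_left hvar zero_le_two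
          calc _ ≤ 2 * (k * d * (2 * B) ^ 2 * M) + M * (2 * (μ - z) ^ 2) := by
                gcongr
                exact hvar
            _ = _ := by ring
  have hM2 := sum_sum_degIn_sq_le (ι := K × Fin d) (V := V)
  rw [hcι] at hM2
  push_cast at hM2
  rw [sum_add_distrib, ← sum_mul, sum_add_distrib, ← mul_sum, ← mul_sum, sum_const, card_univ,
    Fintype.card_fun, hcι, nsmul_eq_mul]
  push_cast
  calc _ ≤ M * (8 * (k * d) * B ^ 2 + 2 * (μ - z) ^ 2) +
        (2 * (k * d + |z|) * (12 * B * (1 / k₀) ^ 2 *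
          (M * ((k * d : ℝ) ^ 2 / m + k * d))) + M * (3 * B * d) ^ 2) * k := by
        gcongr
    _ = _ := by ring

end Bad

end

section

open Filter Topology Asymptotics

section Poisson

variable {N : ℕ → ℕ} {p : ℕ → ℝ} {μ : ℝ}

lemma tendsto_zero_of_tendsto_mul (hN : Tendsto N atTop atTop)
    (h : Tendsto (fun m => N m * p m) atTop (𝓝 μ)) : Tendsto p atTop (𝓝 0) := by
  have h1 : Tendsto (fun m => (N m * p m) * ((N m : ℝ))⁻¹) atTop (𝓝 (μ * 0)) :=
    h.mul (tendsto_inv_atTop_zero.comp (tendsto_natCast_atTop_atTop.comp hN))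
  rw [mul_zero] at h1
  refine h1.congr' ?_
  filter_upwards [hN.eventually_ge_atTop 1] with m hm
  have : (N m : ℝ) ≠ 0 := by positivity
  field_simp

lemma tendsto_one_sub_pow (hN : Tendsto N atTop atTop)
    (h : Tendsto (fun m => N m * p m) atTop (𝓝 μ)) :
    Tendsto (fun m => (1 - p m) ^ N m) atTop (𝓝 (Real.exp (-μ))) := by
  have hp := tendsto_zero_of_tendsto_mul hN h
  have hp1 : ∀ᶠ m in atTop, p m < 1 := hp.eventually_lt_const one_pos
  have hlow : Tendsto (fun m => Real.exp (-(N m * p m / (1 - p m)))) atTop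
      (𝓝 (Real.exp (-(μ / (1 - 0))))) :=
    (Real.continuous_exp.tendsto _).comp
      ((h.div (tendsto_const_nhds.sub hp) (by norm_num)).neg)
  rw [sub_zero, div_one] at hlow
  have hup : Tendsto (fun m => Real.exp (-(N m * p m))) atTop (𝓝 (Real.exp (-μ))) :=
    (Real.continuous_exp.tendsto _).comp h.neg
  refine tendsto_of_tendsto_of_tendsto_of_le_of_le' hlow hup ?_ ?_
  · filter_upwards [hp1] with m hm
    have h1 : 0 < 1 - p m := by linarith
    have h2 : Real.exp (-(p m / (1 - p m))) ≤ 1 - p m := by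
      rw [Real.exp_neg]
      refine inv_le_of_inv_le₀ h1 ?_
      have := Real.add_one_le_exp (p m / (1 - p m))
      refine le_trans (le_of_eq ?_) this
      field_simp
      ring
    calc _ = Real.exp (-(p m / (1 - p m))) ^ N m := by
          rw [← Real.exp_nat_mul]; congr 1; ring
      _ ≤ _ := pow_le_pow_left₀ (Real.exp_pos _).le h2 _
  · filter_upwards [hp1] with m hm
    have h2 : 1 - p m ≤ Real.exp (-p m) := by
      have := Real.add_one_le_exp (-p m)
      linarith
    calc _ ≤ Real.exp (-p m) ^ N m := pow_le_pow_left₀ (by linarith) h2 _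
      _ = _ := by rw [← Real.exp_nat_mul]; congr 1; ring

lemma tendsto_choose_mul_pow_mul_pow (hN : Tendsto N atTop atTop)
    (h : Tendsto (fun m => N m * p m) atTop (𝓝 μ)) (i : ℕ) :
    Tendsto (fun m => (N m).choose i * p m ^ i * (1 - p m) ^ (N m - i)) atTop
      (𝓝 (μ ^ i / i.factorial * Real.exp (-μ))) := by
  have hp := tendsto_zero_of_tendsto_mul hN h
  refine Tendsto.mul ?_ ?_
  · have : (fun m => ((N m).choose i : ℝ) * p m ^ i) ~[atTop]
        (fun m => ((N m : ℝ) * p m) ^ i / i.factorial) := by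
      calc _ ~[atTop] (fun m => ((N m : ℝ) ^ i / i.factorial) * (p m) ^ i) :=
            ((isEquivalent_choose i).comp_tendsto hN).mul IsEquivalent.refl
        _ ~[atTop] _ := EventuallyEq.isEquivalent (.of_eq (by ext; rw [mul_pow]; ring))
    exact (IsEquivalent.tendsto_nhds_iff this).mpr ((h.pow i).div_const _)
  · have h1 : Tendsto (fun m => (1 - p m) ^ N m / (1 - p m) ^ i) atTop
        (𝓝 (Real.exp (-μ) / (1 - 0) ^ i)) :=
      (tendsto_one_sub_pow hN h).div ((tendsto_const_nhds.sub hp).pow i) (by norm_num)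
    rw [sub_zero, one_pow, div_one] at h1
    refine h1.congr' ?_
    filter_upwards [hp.eventually_lt_const one_pos, hN.eventually_ge_atTop i] with m hm hi
    rw [pow_sub₀ _ (by linarith) hi, div_eq_mul_inv]

/-- The weight of a vertex in the core: its degree if that is at least `l`. -/
def coreWeight (l i : ℕ) : ℝ := if l ≤ i then i else 0

/-- The probability that a Poisson variable of mean `μ` is at least `l - 1`. -/
noncomputable def poissonTail (l : ℕ) (μ : ℝ) : ℝ :=
  1 - Real.exp (-μ) * ∑ i ∈ Finset.range (l - 1), μ ^ i / i.factorial

lemma coreWeight_eq (l i : ℕ) :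
    coreWeight l i = i - ∑ q ∈ Finset.range l, (q : ℝ) * (if i = q then 1 else 0) := by
  simp only [coreWeight, mul_ite, mul_one, mul_zero, Finset.sum_ite_eq, Finset.mem_range]
  split_ifs <;> first | omega | simp

lemma binE_coreWeight (l n : ℕ) (r : ℝ) :
    binE r n (coreWeight l) =
      n * r - ∑ q ∈ Finset.range l, (q : ℝ) * (n.choose q * r ^ q * (1 - r) ^ (n - q)) := by
  have h1 := binE_choose r n 1
  simp only [Nat.choose_one_right, pow_one] at h1
  rw [funext (coreWeight_eq l), binE_sub, binE_sum, h1]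
  simp only [binE_const_mul, binE_single]

lemma tendsto_binE_coreWeight {l : ℕ} (hl : 1 ≤ l) (hN : Tendsto N atTop atTop)
    (h : Tendsto (fun m => N m * p m) atTop (𝓝 μ)) :
    Tendsto (fun m => binE (p m) (N m) (coreWeight l)) atTop (𝓝 (μ * poissonTail l μ)) := by
  have h1 : μ * poissonTail l μ =
      μ - ∑ q ∈ Finset.range l, (q : ℝ) * (μ ^ q / q.factorial * Real.exp (-μ)) := by
    obtain ⟨n, rfl⟩ := Nat.exists_eq_add_of_le' hl
    rw [Finset.sum_range_succ', poissonTail, Nat.add_sub_cancel]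
    simp only [Nat.cast_zero, zero_mul, add_zero]
    rw [mul_sub, mul_one, ← mul_assoc, Finset.mul_sum]
    congr 1
    refine Finset.sum_congr rfl fun i _ => ?_
    have : (i.factorial : ℝ) ≠ 0 := by positivity
    rw [Nat.factorial_succ]
    push_cast
    field_simp
    ring
  rw [h1]
  simp only [binE_coreWeight]
  exact h.sub (tendsto_finsetSum _ fun q _ => (tendsto_choose_mul_pow_mul_pow hN h q).const_mul _)

lemma abs_diff_coreWeight_le (l : ℕ) (hl : 1 ≤ l) (i : ℕ) : |diff (coreWeight l) i| ≤ l := by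
  have : (1 : ℝ) ≤ l := by exact_mod_cast hl
  unfold diff coreWeight
  by_cases h : l ≤ i
  · rw [if_pos h, if_pos (by omega)]
    push_cast
    simpa using this
  · by_cases h' : l ≤ i + 1
    · have e : i + 1 = l := by omega
      rw [if_neg h, if_pos h', e]
      simp
    · rw [if_neg h, if_neg h']
      simp

lemma coreWeight_nonneg (l i : ℕ) : 0 ≤ coreWeight l i := by
  unfold coreWeight; split_ifs <;> positivity

lemma coreWeight_le (l i : ℕ) : coreWeight l i ≤ i := by
  unfold coreWeight; split_ifs <;> simp

end Poisson

section Rate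

lemma rate_bounds {d k₀ : ℕ} (hd : 2 ≤ d) (hk₀ : 1 ≤ k₀) {i : ℕ} (hi : k₀ < i) {a : ℝ}
    (ha : a = ((d : ℝ) - 1) / d) :
    ((k₀ : ℝ) / i) ^ a * ((d - 1) / (i * d : ℕ)) ≤
        ((k₀ : ℝ) / (i - 1 : ℕ)) ^ a - ((k₀ : ℝ) / i) ^ a ∧
      ((k₀ : ℝ) / (i - 1 : ℕ)) ^ a - ((k₀ : ℝ) / i) ^ a ≤
        ((k₀ : ℝ) / i) ^ a * ((d - 1) / ((i * d : ℕ) - d)) := by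
  have hd' : (2 : ℝ) ≤ d := by exact_mod_cast hd
  have ha0 : 0 ≤ a := by rw [ha]; exact div_nonneg (by linarith) (by linarith)
  have ha1 : a ≤ 1 := by rw [ha, div_le_one (by linarith)]; linarith
  obtain ⟨j, rfl⟩ := Nat.exists_eq_add_of_le' (show 1 ≤ i by omega)
  rw [Nat.add_sub_cancel]
  have hj : (0 : ℝ) < j := by exact_mod_cast (by omega : 0 < j)
  have hk : (0 : ℝ) < k₀ := by exact_mod_cast hk₀
  set r : ℝ := ((k₀ : ℝ) / (j + 1 : ℕ)) ^ a with hr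
  have hr0 : 0 < r := by positivity
  have e : ((k₀ : ℝ) / j) ^ a = r * (1 + 1 / j) ^ a := by
    rw [hr, ← Real.mul_rpow (by positivity) (by positivity)]
    congr 1
    push_cast
    field_simp
  have e' : r = ((k₀ : ℝ) / j) ^ a * (1 + -(1 / (j + 1))) ^ a := by
    have h0 : (0 : ℝ) ≤ 1 + -(1 / (j + 1)) := by
      rw [← sub_eq_add_neg, sub_nonneg, div_le_one (by linarith)]; linarith
    rw [hr, ← Real.mul_rpow (by positivity) h0]
    congr 1
    push_cast
    field_simp
    ring
  have b1 := rpow_one_add_le_one_add_mul_self (s := 1 / (j : ℝ))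
    (le_trans (by norm_num) (by positivity : (0 : ℝ) ≤ 1 / j)) ha0 ha1
  have b2 := rpow_one_add_le_one_add_mul_self (s := -(1 / ((j : ℝ) + 1)))
    (by rw [neg_le_neg_iff, div_le_one (by linarith)]; linarith) ha0 ha1
  constructor
  · have hx : r ≤ ((k₀ : ℝ) / j) ^ a * (1 + a * -(1 / (j + 1))) := by
      rw [e']
      rw [← e']
      exact e'.le.trans (mul_le_mul_of_nonneg_left b2 (by positivity))
    have hle : r ≤ ((k₀ : ℝ) / j) ^ a := by
      refine hx.trans (mul_le_of_le_one_right (by positivity) ?_)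
      have : 0 ≤ a * (1 / ((j : ℝ) + 1)) := by positivity
      linarith
    have : (d - 1 : ℝ) / ((j + 1) * d : ℕ) = a * (1 / (j + 1)) := by
      rw [ha]; push_cast; field_simp
    rw [this]
    have h3 : r * (a * (1 / ((j : ℝ) + 1))) ≤ ((k₀ : ℝ) / j) ^ a * (a * (1 / (j + 1))) := by
      gcongr
    linarith
  · have : (d - 1 : ℝ) / (((j + 1) * d : ℕ) - d) = a * (1 / j) := by
      rw [ha, show (((j + 1) * d : ℕ) : ℝ) - d = j * d by push_cast; ring]
      field_simp
    rw [this, e]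
    nlinarith

lemma abs_rate_sub_le {d k₀ : ℕ} (hd : 2 ≤ d) (hk₀ : 1 ≤ k₀) {i : ℕ} (hi : k₀ < i) {a : ℝ}
    (ha : a = ((d : ℝ) - 1) / d) :
    |((k₀ : ℝ) / (i - 1 : ℕ)) ^ a - ((k₀ : ℝ) / i) ^ a| ≤ 2 * (d / (i * d : ℕ)) ∧
    |((k₀ : ℝ) / (i - 1 : ℕ)) ^ a - ((k₀ : ℝ) / i) ^ a -
      ((k₀ : ℝ) / i) ^ a * ((d - 1) / ((i * d : ℕ) - 1))| ≤ 2 * (d / (i * d : ℕ)) ^ 2 := by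
  obtain ⟨h1, h2⟩ := rate_bounds hd hk₀ hi ha
  have hd' : (2 : ℝ) ≤ d := by exact_mod_cast hd
  have ha0 : 0 ≤ a := by rw [ha]; exact div_nonneg (by linarith) (by linarith)
  have hk : (0 : ℝ) < k₀ := by exact_mod_cast hk₀
  have hik : (k₀ : ℝ) ≤ i := by exact_mod_cast hi.le
  have hi2 : (2 : ℝ) ≤ i := by exact_mod_cast (by omega : 2 ≤ i)
  have hn : 2 * (d : ℝ) ≤ (i * d : ℕ) := by push_cast; nlinarith
  set n : ℝ := ((i * d : ℕ) : ℝ)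
  have hn0 : 0 < n := by linarith
  set r : ℝ := ((k₀ : ℝ) / i) ^ a with hr
  have hr0 : 0 ≤ r := by positivity
  have hr1 : r ≤ 1 := Real.rpow_le_one (by positivity) (by rw [div_le_one (by linarith)]; exact hik) ha0
  have q1 : (d - 1 : ℝ) / (n - d) ≤ 2 * (d / n) := by
    rw [← mul_div_assoc, div_le_div_iff₀ (by linarith) (by linarith)]
    nlinarith
  have q2 : (d - 1 : ℝ) / (n - d) - (d - 1) / (n - 1) ≤ 2 * (d / n) ^ 2 := by
    have : (d - 1 : ℝ) / (n - d) - (d - 1) / (n - 1) = (d - 1) ^ 2 / ((n - d) * (n - 1)) := by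
      rw [div_sub_div _ _ (by linarith) (by linarith)]; ring
    rw [this, div_pow, ← mul_div_assoc,
      div_le_div_iff₀ (mul_pos (by linarith) (by linarith)) (by positivity)]
    have s1 : (d - 1 : ℝ) ^ 2 * n ≤ d ^ 2 * (n - 1) := by nlinarith
    have s2 : n ≤ 2 * (n - d) := by linarith
    calc (d - 1 : ℝ) ^ 2 * n ^ 2 = ((d - 1 : ℝ) ^ 2 * n) * n := by ring
      _ ≤ (d ^ 2 * (n - 1)) * (2 * (n - d)) :=
        mul_le_mul s1 s2 (by linarith) (mul_nonneg (by positivity) (by linarith))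
      _ = _ := by ring
  have q3 : (d - 1 : ℝ) / (n - 1) - (d - 1) / n ≤ 2 * (d / n) ^ 2 := by
    have : (d - 1 : ℝ) / (n - 1) - (d - 1) / n = (d - 1) / ((n - 1) * n) := by
      rw [div_sub_div _ _ (by linarith) (by linarith)]; ring
    rw [this, div_pow, ← mul_div_assoc,
      div_le_div_iff₀ (mul_pos (by linarith) (by linarith)) (by nlinarith)]
    have s3 : (d - 1 : ℝ) * n ≤ 2 * d ^ 2 * (n - 1) :=
      calc (d - 1 : ℝ) * n ≤ d ^ 2 * (2 * (n - 1)) :=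
            mul_le_mul (by nlinarith) (by linarith) hn0.le (by positivity)
        _ = _ := by ring
    calc (d - 1 : ℝ) * n ^ 2 = ((d - 1) * n) * n := by ring
      _ ≤ (2 * d ^ 2 * (n - 1)) * n := by gcongr
      _ = _ := by ring
  have p0 : (0 : ℝ) ≤ (d - 1) / n := div_nonneg (by linarith) (by linarith)
  have p1 : (0 : ℝ) ≤ (d - 1) / (n - d) := div_nonneg (by linarith) (by linarith)
  have p2 : (0 : ℝ) ≤ 2 * (d / n) ^ 2 := by positivity
  constructor
  · rw [abs_of_nonneg (by nlinarith)]
    nlinarith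
  · rw [abs_le]
    constructor <;> nlinarith

end Rate

end

section

open Filter Topology

lemma tendsto_edges_atTop {c : ℝ} (hc : 0 < c) :
    Tendsto (fun m : ℕ => ⌊c * m⌋₊) atTop atTop :=
  tendsto_nat_floor_atTop.comp (tendsto_natCast_atTop_atTop.const_mul_atTop hc)

lemma tendsto_edges_div {c : ℝ} (hc : 0 < c) :
    Tendsto (fun m : ℕ => (⌊c * m⌋₊ : ℝ) / m) atTop (𝓝 c) :=
  (tendsto_nat_floor_mul_div_atTop hc.le).comp tendsto_natCast_atTop_atTop

theorem tendsto_card_bad_div {d l : ℕ} (hd : 2 ≤ d) (hl : 1 ≤ l) {c s γ a : ℝ} (hc : 0 < c)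
    (hs : 0 < s) (hs1 : s ≤ 1) (hγ : 0 < γ) (ha : a = ((d : ℝ) - 1) / d)
    (Bad : ∀ m : ℕ, (Fin ⌊c * m⌋₊ × Fin d → Fin m) → Prop) [∀ m, DecidablePred (Bad m)]
    (h1 : ∀ᶠ m : ℕ in atTop, ∀ (f : Fin ⌊c * m⌋₊ × Fin d → Fin m) (I : Finset (Fin ⌊c * m⌋₊)),
      ⌊s * ⌊c * m⌋₊⌋₊ < I.card → IsCore l f I → ¬ Bad m f)
    (h2 : ∀ᶠ m : ℕ in atTop, ∀ (f : Fin ⌊c * m⌋₊ × Fin d → Fin m) (I : Finset (Fin ⌊c * m⌋₊)),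
      I.card = ⌊s * ⌊c * m⌋₊⌋₊ → (∀ T, IsCore l f T → T ⊆ I) →
      |∑ v, coreWeight l (degIn f (I ×ˢ Finset.univ) v) -
        (c * d * s ^ a) * poissonTail l (c * d * s ^ a) * m| < γ * m → ¬ Bad m f) :
    Tendsto (fun m : ℕ => (((Finset.univ.filter (Bad m)).card : ℝ) / (m : ℝ) ^ (⌊c * m⌋₊ * d)))
      atTop (𝓝 0) := by
  set θ := s ^ a with hθ
  set ζ := (c * d * θ) * poissonTail l (c * d * θ) with hζ
  have hd' : (2 : ℝ) ≤ d := by exact_mod_cast hd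
  have ha0 : 0 ≤ a := by rw [ha]; exact div_nonneg (by linarith) (by linarith)
  set k : ℕ → ℕ := fun m => ⌊c * m⌋₊ with hk
  set k₀ : ℕ → ℕ := fun m => ⌊s * k m⌋₊ with hk₀
  have hkt : Tendsto k atTop atTop := tendsto_edges_atTop hc
  have hk₀t : Tendsto k₀ atTop atTop := (tendsto_edges_atTop hs).comp hkt
  have hx : Tendsto (fun m : ℕ => (k m : ℝ) / m) atTop (𝓝 c) := tendsto_edges_div hc
  have hks : Tendsto (fun m => (k₀ m : ℝ) / k m) atTop (𝓝 s) := (tendsto_edges_div hs).comp hkt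
  have hinv : Tendsto (fun m : ℕ => ((m : ℝ))⁻¹) atTop (𝓝 0) := tendsto_inv_atTop_nhds_zero_nat
  set p : ℕ → ℝ := fun m => ((k₀ m : ℝ) / k m) ^ a / m with hp
  have hN : Tendsto (fun m => k m * d) atTop atTop :=
    hkt.atTop_mul_const' (by omega)
  have hrate : Tendsto (fun m => ((k m * d : ℕ) : ℝ) * p m) atTop (𝓝 (c * d * θ)) := by
    have := (hx.mul_const (d : ℝ)).mul (hks.rpow_const (p := a) (Or.inl hs.ne'))
    refine this.congr fun m => ?_
    simp only [hp]; push_cast; ring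
  have hb : Tendsto (fun m => binE (p m) (k m * d) (coreWeight l)) atTop (𝓝 ζ) :=
    tendsto_binE_coreWeight hl hN hrate
  have hy : Tendsto (fun m : ℕ => (m : ℝ) / k₀ m) atTop (𝓝 (s⁻¹ * c⁻¹)) := by
    refine ((hks.inv₀ hs.ne').mul (hx.inv₀ hc.ne')).congr' ?_
    filter_upwards [hkt.eventually_ge_atTop 1] with m hm
    have : (k m : ℝ) ≠ 0 := by positivity
    field_simp
  have hbound : Tendsto (fun m : ℕ => (γ⁻¹) ^ 2 * (
      8 * ((k m : ℝ) / m * d) * (l : ℝ) ^ 2 * (m : ℝ)⁻¹ +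
        2 * (binE (p m) (k m * d) (coreWeight l) - ζ) ^ 2 +
      (2 * ((k m : ℝ) / m * d + |ζ|) * (12 * l * ((m : ℝ) / k₀ m) ^ 2 *
          (((k m : ℝ) / m * d) ^ 2 + (k m : ℝ) / m * d)) + (3 * l * d) ^ 2) *
            ((k m : ℝ) / m) * (m : ℝ)⁻¹)) atTop (𝓝 ((γ⁻¹) ^ 2 * (
      8 * (c * d) * (l : ℝ) ^ 2 * 0 + 2 * (ζ - ζ) ^ 2 +
      (2 * (c * d + |ζ|) * (12 * l * (s⁻¹ * c⁻¹) ^ 2 *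
          ((c * d) ^ 2 + c * d)) + (3 * l * d) ^ 2) * c * 0))) := by
    have hxd := hx.mul_const (d : ℝ)
    refine Tendsto.const_mul _ (Tendsto.add (Tendsto.add ?_ ?_) ?_)
    · exact ((hxd.const_mul 8).mul_const _).mul hinv
    · exact ((hb.sub_const ζ).pow 2).const_mul 2
    · exact ((((hxd.add_const _).const_mul 2).mul (((hy.pow 2).const_mul _).mul
        ((hxd.pow 2).add hxd))).add_const _).mul hx |>.mul hinv
  rw [show (γ⁻¹) ^ 2 * (8 * (c * d) * (l : ℝ) ^ 2 * 0 + 2 * (ζ - ζ) ^ 2 +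
      (2 * (c * d + |ζ|) * (12 * l * (s⁻¹ * c⁻¹) ^ 2 *
          ((c * d) ^ 2 + c * d)) + (3 * l * d) ^ 2) * c * 0) = 0 by ring] at hbound
  refine tendsto_of_tendsto_of_tendsto_of_le_of_le' tendsto_const_nhds hbound
    (Eventually.of_forall fun m => by positivity) ?_
  filter_upwards [h1, h2, hk₀t.eventually_ge_atTop 1, hkt.eventually_ge_atTop 1,
    eventually_ge_atTop 1] with m hm1 hm2 hmk₀ hmk hm
  have hm' : (0 : ℝ) < m := by exact_mod_cast hm
  have hne : Nonempty (Fin m) := ⟨⟨0, hm⟩⟩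
  have hk₀r : (0 : ℝ) < k₀ m := by exact_mod_cast hmk₀
  have hkk : k₀ m ≤ k m :=
    Nat.floor_le_of_le (mul_le_of_le_one_left (Nat.cast_nonneg _) hs1)
  have main := sq_mul_card_filter_le (K := Fin (k m)) (V := Fin m) (l := l) (B := l) (z := ζ * m)
    (G := γ * m) (k₀ := k₀ m) (rho := fun i => ((k₀ m : ℝ) / i) ^ a) (u := coreWeight l)
    hd hmk₀ (by simpa using hkk) (by positivity) (fun i => by positivity)
    (fun i hi => Real.rpow_le_one (by positivity)
      (div_le_one_of_le₀ (by exact_mod_cast hi) (Nat.cast_nonneg _)) ha0)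
    (by simp only [div_self hk₀r.ne', Real.one_rpow])
    (fun i hi => (abs_rate_sub_le hd hmk₀ hi ha).1)
    (fun i hi => (abs_rate_sub_le hd hmk₀ hi ha).2)
    (abs_diff_coreWeight_le l hl) (fun i hi => if_neg (by omega)) (coreWeight_nonneg l)
    (coreWeight_le l) (Bad m) hm1 hm2
  simp only [Fintype.card_fin] at main
  change _ ≤ _ * (_ + 2 * (m * binE (p m) (k m * d) (coreWeight l) - ζ * m) ^ 2 + _) at main
  rw [abs_mul, abs_of_pos hm'] at main
  change _ / (m : ℝ) ^ (k m * d) ≤ _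
  have hM : (0 : ℝ) < (m : ℝ) ^ (k m * d) := by positivity
  rw [div_le_iff₀ hM]
  have hG : 0 < (γ * m) ^ 2 := by positivity
  refine le_of_mul_le_mul_left (main.trans (le_of_eq ?_)) hG
  field_simp

end

section

open Finset

section SmallCores

variable {K : Type*} [Fintype K] [DecidableEq K] {d : ℕ} {V : Type*} [Fintype V] [DecidableEq V]

lemma card_filter_forall_mem (T : Finset K) (W : Finset V) :
    #{f : K × Fin d → V | ∀ p, p.1 ∈ T → f p ∈ W} =
      #W ^ (#T * d) * Fintype.card V ^ ((Fintype.card K - #T) * d) := by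
  have : ({f : K × Fin d → V | ∀ p, p.1 ∈ T → f p ∈ W} : Finset _) =
      Fintype.piFinset fun p : K × Fin d => if p.1 ∈ T then W else univ := by
    ext f
    simp only [mem_filter, mem_univ, true_and, Fintype.mem_piFinset]
    refine forall_congr' fun p => ?_
    split_ifs with h <;> simp [h]
  have hprod : ∏ p : K × Fin d, #(if p.1 ∈ T then W else univ) =
      ∏ i : K, (if i ∈ T then #W else Fintype.card V) ^ d := by
    rw [Fintype.prod_prod_type]
    refine prod_congr rfl fun i _ => ?_
    by_cases h : i ∈ T <;> simp [h]
  rw [this, Fintype.card_piFinset, hprod, prod_pow, prod_ite]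
  simp only [prod_const]
  rw [filter_mem_eq_inter, univ_inter, filter_not, filter_mem_eq_inter, univ_inter,
    card_sdiff_of_subset (subset_univ _), card_univ, mul_pow, pow_mul, pow_mul]

omit [Fintype V] [Fintype K] [DecidableEq K] in
lemma IsCore.mul_card_image_le {l : ℕ} {f : K × Fin d → V} {T : Finset K} (h : IsCore l f T) :
    l * #((T ×ˢ univ).image f) ≤ #T * d := by
  have h1 : #(T ×ˢ (univ : Finset (Fin d))) = #T * d := by simp
  rw [← h1, card_eq_sum_card_image f, mul_comm, ← smul_eq_mul, ← sum_const]
  refine sum_le_sum fun v hv => h v ?_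
  obtain ⟨p, hp, rfl⟩ := mem_image.1 hv
  exact degIn_pos_of_mem f hp

lemma card_small_core_le {l : ℕ} (hl : 1 ≤ l) (τ : ℕ)
    (hτ : ∀ t ≤ τ, t * d / l ≤ Fintype.card V) (Bad : (K × Fin d → V) → Prop) [DecidablePred Bad]
    (hBad : ∀ f, Bad f → ∃ T : Finset K, T.Nonempty ∧ #T ≤ τ ∧ IsCore l f T) :
    #{f | Bad f} ≤ ∑ t ∈ Icc 1 τ, (Fintype.card K).choose t *
      ((Fintype.card V).choose (t * d / l) *
        ((t * d / l) ^ (t * d) * Fintype.card V ^ ((Fintype.card K - t) * d))) := by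
  have hsub : ({f | Bad f} : Finset (K × Fin d → V)) ⊆ (Icc 1 τ).biUnion fun t =>
      (powersetCard t univ).biUnion fun T => (powersetCard (t * d / l) univ).biUnion fun W =>
        {f : K × Fin d → V | ∀ p, p.1 ∈ T → f p ∈ W} := by
    intro f hf
    obtain ⟨T, hT0, hTτ, hT⟩ := hBad f (mem_filter.1 hf).2
    have hc : #((T ×ˢ univ).image f) ≤ #T * d / l :=
      (Nat.le_div_iff_mul_le hl).2 (by rw [mul_comm]; exact hT.mul_card_image_le)
    obtain ⟨W, hW, -, hWc⟩ := exists_subsuperset_card_eq (subset_univ ((T ×ˢ univ).image f)) hc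
      (by rw [card_univ]; exact hτ _ hTτ)
    simp only [mem_biUnion, mem_powersetCard_univ, mem_Icc, mem_filter, mem_univ, true_and]
    exact ⟨#T, ⟨hT0.card_pos, hTτ⟩, T, rfl, W, hWc, fun p hp =>
      hW (mem_image_of_mem f (mem_product.2 ⟨hp, mem_univ _⟩))⟩
  refine (card_le_card hsub).trans (card_biUnion_le.trans (sum_le_sum fun t _ => ?_))
  rw [← card_univ (α := K), ← card_powersetCard]
  refine card_biUnion_le_card_mul _ _ _ fun T hT => ?_
  rw [← card_univ (α := V), ← card_powersetCard]
  refine card_biUnion_le_card_mul _ _ _ fun W hW => le_of_eq ?_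
  rw [card_filter_forall_mem, (mem_powersetCard.1 hT).2, (mem_powersetCard.1 hW).2, card_univ,
    card_univ]

end SmallCores

lemma choose_le_exp_mul_div_pow (n t : ℕ) :
    (n.choose t : ℝ) * t ^ t ≤ (Real.exp 1 * n) ^ t := by
  have h1 := Nat.choose_le_pow_div (α := ℝ) t n
  have h2 := Real.pow_div_factorial_le_exp (t : ℝ) (Nat.cast_nonneg t) t
  have h3 : (0 : ℝ) < t.factorial := by positivity
  rw [mul_pow, ← Real.exp_nat_mul, mul_one]
  rw [le_div_iff₀ h3] at h1
  rw [div_le_iff₀ h3] at h2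
  have h4 : (0 : ℝ) ≤ t ^ t := by positivity
  have h5 : (0 : ℝ) ≤ n ^ t := by positivity
  refine le_of_mul_le_mul_right ?_ h3
  calc _ = (n.choose t * t.factorial : ℝ) * t ^ t := by ring
    _ ≤ n ^ t * (Real.exp t * t.factorial) := by gcongr
    _ = _ := by ring

lemma small_core_term_le {d l k m t : ℕ} {c : ℝ} (hl : 2 ≤ l) (hd : 2 ≤ d) (hdl : 4 < d + l)
    (ht : 1 ≤ t) (htk : t ≤ k) (hm : 1 ≤ m) (hk : (k : ℝ) ≤ c * m)
    (hy : (t * d : ℝ) ≤ l * m) :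
    ((k.choose t * (m.choose (t * d / l) * ((t * d / l) ^ (t * d) * m ^ ((k - t) * d))) : ℕ) : ℝ) ≤
      (m : ℝ) ^ (k * d) *
        (Real.exp 1 * c * Real.exp 1 ^ d * (d / l) * ((t * d : ℝ) / (l * m)) ^ ((l : ℝ)⁻¹)) ^ t := by
  set w := t * d / l with hw
  have hl0 : (0 : ℝ) < l := by exact_mod_cast (by omega : 0 < l)
  have hm0 : (0 : ℝ) < m := by exact_mod_cast hm
  have ht0 : (0 : ℝ) < t := by exact_mod_cast ht
  have hc0 : 0 ≤ c := by
    have : 0 ≤ c * m := (Nat.cast_nonneg k).trans hk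
    exact nonneg_of_mul_nonneg_left this hm0
  have hwl : w * l ≤ t * d := Nat.div_mul_le_self _ _
  have hwtd : w ≤ t * d := Nat.div_le_self _ _
  set y : ℝ := (t * d : ℝ) / (l * m) with hydef
  have hy0 : 0 ≤ y := by positivity
  have hy1 : y ≤ 1 := div_le_one_of_le₀ hy (by positivity)
  set z : ℝ := y ^ ((l : ℝ)⁻¹) with hz
  have hz0 : 0 ≤ z := by positivity
  have hz1 : z ≤ 1 := Real.rpow_le_one hy0 hy1 (by positivity)
  have hzl : z ^ l = y := Real.rpow_inv_natCast_pow hy0 (by omega)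
  have hwy : (w : ℝ) ≤ y * m := by
    have : (w : ℝ) * l ≤ t * d := by exact_mod_cast hwl
    rw [hydef, div_mul_eq_mul_div, le_div_iff₀ (by positivity)]
    nlinarith
  have e1 : (k.choose t : ℝ) ≤ (Real.exp 1 * c * m / t) ^ t := by
    rw [div_pow, le_div_iff₀ (by positivity)]
    refine (choose_le_exp_mul_div_pow k t).trans ?_
    rw [mul_assoc]
    gcongr
  have e3 : y ^ (t * d - w) ≤ (y * z) ^ t := by
    rw [← hzl, ← pow_succ, ← pow_mul, ← pow_mul]
    refine pow_le_pow_of_le_one hz0 hz1 ?_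
    have h1 : l * (t * d - w) = l * (t * d) - w * l := by rw [Nat.mul_sub, mul_comm w]
    have h2 : (l + 1) * t + t * d ≤ l * (t * d) := by
      have h3 : l + 1 + d ≤ l * d := by
        obtain ⟨a, rfl⟩ := Nat.exists_eq_add_of_le hl
        obtain ⟨b, rfl⟩ := Nat.exists_eq_add_of_le hd
        have : 1 ≤ a + b := by omega
        nlinarith [Nat.zero_le (a * b)]
      nlinarith
    omega
  have e2 : (m.choose w : ℝ) * (w : ℝ) ^ (t * d) ≤
      m ^ (t * d) * ((Real.exp 1 ^ d) ^ t * (y * z) ^ t) := by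
    calc (m.choose w : ℝ) * (w : ℝ) ^ (t * d)
        = (m.choose w * (w : ℝ) ^ w) * (w : ℝ) ^ (t * d - w) := by
          rw [mul_assoc, ← pow_add, Nat.add_sub_cancel' hwtd]
      _ ≤ (Real.exp 1 * m) ^ w * (y * m) ^ (t * d - w) := by
          gcongr
          exact choose_le_exp_mul_div_pow m w
      _ = m ^ (t * d) * (Real.exp 1 ^ w * y ^ (t * d - w)) := by
          rw [mul_pow, mul_pow]
          nth_rewrite 3 [← Nat.add_sub_cancel' hwtd]
          rw [pow_add]; ring
      _ ≤ _ := by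
          gcongr
          rw [← pow_mul]
          exact pow_le_pow_right₀ (Real.one_le_exp zero_le_one) (by rwa [mul_comm d])
  have hkd : (m : ℝ) ^ (k * d) = m ^ (t * d) * m ^ ((k - t) * d) := by
    rw [← pow_add, ← add_mul, Nat.add_sub_cancel' htk]
  push_cast
  calc (k.choose t : ℝ) * (m.choose w * ((w : ℝ) ^ (t * d) * m ^ ((k - t) * d)))
      = k.choose t * (m.choose w * (w : ℝ) ^ (t * d)) * m ^ ((k - t) * d) := by ring
    _ ≤ (Real.exp 1 * c * m / t) ^ t * (m ^ (t * d) * ((Real.exp 1 ^ d) ^ t * (y * z) ^ t)) *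
        m ^ ((k - t) * d) := by gcongr
    _ = (m : ℝ) ^ (k * d) * (Real.exp 1 * c * m / t * Real.exp 1 ^ d * (y * z)) ^ t := by
        rw [hkd, mul_pow _ (y * z), mul_pow _ (Real.exp 1 ^ d)]; ring
    _ = _ := by
        congr 2
        rw [hydef]
        field_simp

open Filter Topology in
theorem exists_small_cores_negligible {d l : ℕ} (hd : 2 ≤ d) (hl : 2 ≤ l) (hdl : 4 < d + l) {c : ℝ}
    (hc : 0 < c) : ∃ δ : ℝ, 0 < δ ∧ δ ≤ 1 ∧
      ∀ (Bad : ∀ m : ℕ, (Fin ⌊c * m⌋₊ × Fin d → Fin m) → Prop) [∀ m, DecidablePred (Bad m)],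
        (∀ m f, Bad m f → ∃ T : Finset (Fin ⌊c * m⌋₊), T.Nonempty ∧
          (#T : ℝ) ≤ δ * ⌊c * m⌋₊ ∧ IsCore l f T) →
        Tendsto (fun m : ℕ => (#(univ.filter (Bad m)) : ℝ) / (m : ℝ) ^ (⌊c * m⌋₊ * d))
          atTop (𝓝 0) := by
  have hl0 : (0 : ℝ) < l := by exact_mod_cast (by omega : 0 < l)
  have hd0 : (0 : ℝ) < d := by exact_mod_cast (by omega : 0 < d)
  set C : ℝ := Real.exp 1 * c * Real.exp 1 ^ d * (d / l) with hC
  have hC0 : 0 < C := by positivity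
  set y₀ : ℝ := min 1 ((1 / (2 * C)) ^ l) with hy₀
  have hy₀0 : 0 < y₀ := by positivity
  refine ⟨min 1 (y₀ * l / (d * c)), by positivity, min_le_left _ _, ?_⟩
  intro Bad _ hBad
  set δ : ℝ := min 1 (y₀ * l / (d * c)) with hδ
  have hr : Tendsto (fun m : ℕ => 4 * C * ((d : ℝ) / (l * m)) ^ ((l : ℝ)⁻¹)) atTop (𝓝 0) := by
    have h1 : Tendsto (fun m : ℕ => (d : ℝ) / (l * m)) atTop (𝓝 0) :=
      tendsto_const_nhds.div_atTop (tendsto_natCast_atTop_atTop.const_mul_atTop hl0)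
    have h2 := (h1.rpow_const (p := (l : ℝ)⁻¹) (Or.inr (by positivity))).const_mul (4 * C)
    rwa [Real.zero_rpow (by positivity), mul_zero] at h2
  refine tendsto_of_tendsto_of_tendsto_of_le_of_le' tendsto_const_nhds hr
    (Eventually.of_forall fun m => by positivity) ?_
  filter_upwards [eventually_ge_atTop 1] with m hm
  have hm0 : (0 : ℝ) < m := by exact_mod_cast hm
  set k := ⌊c * m⌋₊ with hk
  have hkc : (k : ℝ) ≤ c * m := Nat.floor_le (by positivity)
  set τ := ⌊δ * k⌋₊ with hτ
  have hδ0 : 0 < δ := by positivity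
  have hτk : τ ≤ k :=
    Nat.floor_le_of_le (mul_le_of_le_one_left (Nat.cast_nonneg _) (min_le_left _ _))
  have hyt : ∀ t ≤ τ, (t * d : ℝ) / (l * m) ≤ y₀ := by
    intro t ht
    have h1 : (t : ℝ) ≤ δ * k := (Nat.cast_le.2 ht).trans (Nat.floor_le (by positivity))
    have h2 : δ ≤ y₀ * l / (d * c) := min_le_right _ _
    rw [div_le_iff₀ (by positivity)]
    calc (t : ℝ) * d ≤ (y₀ * l / (d * c) * (c * m)) * d := by gcongr; exact h1.trans (by gcongr)
      _ = _ := by field_simp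
  have hyt1 : ∀ t ≤ τ, (t * d : ℝ) ≤ l * m := by
    intro t ht
    have := (hyt t ht).trans (min_le_left _ _)
    rwa [div_le_one (by positivity)] at this
  have hcount := card_small_core_le (K := Fin k) (V := Fin m) (d := d) (l := l) (by omega) τ
    (fun t ht => by
      rw [Fintype.card_fin]
      refine Nat.div_le_of_le_mul ?_
      exact_mod_cast hyt1 t ht) (Bad m)
    (fun f hf => by
      obtain ⟨T, h1, h2, h3⟩ := hBad m f hf
      exact ⟨T, h1, Nat.le_floor h2, h3⟩)
  rw [div_le_iff₀ (by positivity)]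
  refine (Nat.cast_le (α := ℝ).2 hcount).trans ?_
  simp only [Fintype.card_fin]
  rw [Nat.cast_sum]
  set ρ : ℝ := ((d : ℝ) / (l * m)) ^ ((l : ℝ)⁻¹) with hρ
  have hρ0 : 0 ≤ ρ := by positivity
  have hterm : ∀ t ∈ Icc 1 τ,
      ((k.choose t * (m.choose (t * d / l) * ((t * d / l) ^ (t * d) * m ^ ((k - t) * d))) : ℕ) : ℝ) ≤
        (m : ℝ) ^ (k * d) * (2 * C * ρ) * (t * (1 / 2) ^ t) := by
    intro t ht
    rw [mem_Icc] at ht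
    refine (small_core_term_le hl hd hdl ht.1 (ht.2.trans hτk) hm hkc (hyt1 t ht.2)).trans ?_
    rw [← hC, mul_assoc ((m : ℝ) ^ (k * d))]
    refine mul_le_mul_of_nonneg_left ?_ (by positivity)
    set z : ℝ := ((t * d : ℝ) / (l * m)) ^ ((l : ℝ)⁻¹) with hz
    have hz0 : 0 ≤ z := by positivity
    have hz1 : C * z ≤ 1 / 2 := by
      have : z ≤ 1 / (2 * C) := by
        rw [hz]
        refine (Real.rpow_le_rpow (by positivity)
          ((hyt t ht.2).trans (min_le_right _ _)) (by positivity)).trans (le_of_eq ?_)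
        exact Real.pow_rpow_inv_natCast (by positivity) (by omega)
      calc C * z ≤ C * (1 / (2 * C)) := by gcongr
        _ = 1 / 2 := by field_simp
    have hz2 : z ≤ t * ρ := by
      rw [hz, hρ, mul_div_assoc, Real.mul_rpow (by positivity) (by positivity)]
      gcongr
      refine Real.rpow_le_self_of_one_le (by exact_mod_cast ht.1) ?_
      exact inv_le_one_of_one_le₀ (by exact_mod_cast (by omega : 1 ≤ l))
    obtain ⟨n, rfl⟩ := Nat.exists_eq_add_of_le' ht.1
    calc (C * z) ^ (n + 1) = (C * z) ^ n * (C * z) := pow_succ _ _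
      _ ≤ (1 / 2) ^ n * (C * ((n + 1 : ℕ) * ρ)) := by gcongr
      _ = _ := by rw [pow_succ]; ring
  refine (sum_le_sum hterm).trans ?_
  rw [← mul_sum]
  have hgeo : ∑ t ∈ Icc 1 τ, (t : ℝ) * (1 / 2) ^ t ≤ 2 := by
    have h := hasSum_coe_mul_geometric_of_norm_lt_one (𝕜 := ℝ) (r := 1 / 2) (by norm_num)
    have := sum_le_hasSum (Icc 1 τ) (fun t _ => by positivity) h
    norm_num at this ⊢
    exact this
  calc _ ≤ (m : ℝ) ^ (k * d) * (2 * C * ρ) * 2 := by gcongr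
    _ = _ := by ring

end

section

open Finset

section Transfer

variable {K : Type*} {d m : ℕ}

/-- Orders the vertices of each hyperedge, by size and then rearranged by `σ`. -/
def toSlots (E : K → {s : Finset (Fin m) // s.card = d}) (σ : K → Equiv.Perm (Fin d))
    (p : K × Fin d) : Fin m :=
  (E p.1).1.orderEmbOfFin (E p.1).2 (σ p.1 p.2)

lemma exists_toSlots_eq_iff (E : K → {s : Finset (Fin m) // s.card = d})
    (σ : K → Equiv.Perm (Fin d)) (i : K) (v : Fin m) :
    (∃ a, toSlots E σ (i, a) = v) ↔ v ∈ (E i).1 := by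
  have h := Set.ext_iff.1 (range_orderEmbOfFin (E i).1 (E i).2) v
  rw [mem_coe, Set.mem_range] at h
  rw [← h]
  exact (σ i).exists_congr_left.trans (by simp [toSlots])

lemma toSlots_injective : Function.Injective
    fun q : (K → {s : Finset (Fin m) // s.card = d}) × (K → Equiv.Perm (Fin d)) =>
      toSlots q.1 q.2 := by
  rintro ⟨E, σ⟩ ⟨E', σ'⟩ h
  dsimp only at h
  have hE : E = E' := by
    funext i
    ext v
    rw [← exists_toSlots_eq_iff E σ, h, exists_toSlots_eq_iff]
  subst hE
  congr 1
  funext i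
  ext1 a
  exact (orderEmbOfFin (E i).1 (E i).2).injective (congrFun h (i, a))

lemma degIn_toSlots (E : K → {s : Finset (Fin m) // s.card = d}) (σ : K → Equiv.Perm (Fin d))
    (T : Finset K) (v : Fin m) :
    degIn (toSlots E σ) (T ×ˢ univ) v = #{t ∈ T | v ∈ (E t).1} := by
  classical
  have : (T.filter fun t => v ∈ (E t).1) =
      ({p ∈ T ×ˢ univ | toSlots E σ p = v} : Finset (K × Fin d)).image Prod.fst := by
    ext t
    simp only [mem_filter, mem_image, mem_product, mem_univ, and_true, Prod.exists,
      ← exists_toSlots_eq_iff E σ]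
    constructor
    · rintro ⟨ht, a, ha⟩
      exact ⟨t, a, ⟨ht, ha⟩, rfl⟩
    · rintro ⟨_, a, ⟨ht, ha⟩, rfl⟩
      exact ⟨ht, a, ha⟩
  rw [this, card_image_of_injOn]
  · rfl
  · rintro ⟨i, a⟩ hp ⟨j, b⟩ hq (rfl : i = j)
    rw [mem_coe, mem_filter] at hp hq
    congr 1
    exact (σ i).injective ((orderEmbOfFin (E i).1 (E i).2).injective (hp.2.trans hq.2.symm))

lemma isCore_toSlots_iff {l : ℕ} (E : K → {s : Finset (Fin m) // s.card = d})
    (σ : K → Equiv.Perm (Fin d)) (T : Finset K) :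
    IsCore l (toSlots E σ) T ↔
      ∀ v, (∃ t ∈ T, v ∈ (E t).1) → l ≤ #{t ∈ T | v ∈ (E t).1} := by
  unfold IsCore
  simp only [degIn_toSlots, card_ne_zero, filter_nonempty_iff]

lemma image_toSlots (E : K → {s : Finset (Fin m) // s.card = d}) (σ : K → Equiv.Perm (Fin d))
    (T : Finset K) : (T ×ˢ univ).image (toSlots E σ) = T.biUnion fun t => (E t).1 := by
  ext v
  simp only [mem_image, mem_product, mem_univ, and_true, mem_biUnion, Prod.exists,
    ← exists_toSlots_eq_iff E σ]
  constructor
  · rintro ⟨t, a, ht, h⟩; exact ⟨t, ht, a, h⟩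
  · rintro ⟨t, ht, a, h⟩; exact ⟨t, a, ht, h⟩

lemma card_filter_mul_factorial_pow_le [Fintype K] [DecidableEq K]
    (P : (K → {s : Finset (Fin m) // s.card = d}) → Prop) [DecidablePred P]
    (Q : (K × Fin d → Fin m) → Prop) [DecidablePred Q] (h : ∀ E σ, P E → Q (toSlots E σ)) :
    #{E | P E} * d.factorial ^ Fintype.card K ≤ #{f | Q f} := by
  have : #(({E | P E} : Finset (K → {s : Finset (Fin m) // s.card = d})) ×ˢ
      (univ : Finset (K → Equiv.Perm (Fin d)))) = #{E | P E} * d.factorial ^ Fintype.card K := by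
    rw [card_product, card_univ, Fintype.card_fun, Fintype.card_perm, Fintype.card_fin]
  rw [← this]
  refine card_le_card_of_injOn (fun q => toSlots q.1 q.2) ?_ toSlots_injective.injOn
  rintro ⟨E, σ⟩ hq
  simp only [coe_product, Set.mem_prod, mem_coe, mem_filter, mem_univ, true_and, and_true] at hq
  simpa using h E σ hq

lemma pow_le_exp_mul_descFactorial_pow {d k m : ℕ} {c : ℝ} (hk : (k : ℝ) ≤ c * m)
    (hm : 2 * d + 1 ≤ m) :
    (m : ℝ) ^ (k * d) ≤ Real.exp (2 * d ^ 2 * c) * (m.descFactorial d : ℝ) ^ k := by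
  have hm' : 2 * (d : ℝ) + 1 ≤ m := by exact_mod_cast hm
  have hd0 : (0 : ℝ) ≤ d := Nat.cast_nonneg d
  have h1 : ((m : ℝ) - d) ^ d ≤ m.descFactorial d := by
    have h2 : (m - d) ^ d ≤ m.descFactorial d :=
      (Nat.pow_le_pow_left (by omega) d).trans (Nat.pow_sub_le_descFactorial m d)
    have h3 : (m : ℝ) - d = (m - d : ℕ) := by rw [Nat.cast_sub (by omega)]
    rw [h3]
    exact_mod_cast h2
  have h2 : (m : ℝ) ≤ Real.exp (d / (m - d)) * (m - d) := by
    have := Real.add_one_le_exp ((d : ℝ) / (m - d))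
    calc (m : ℝ) = (d / (m - d) + 1) * (m - d) := by
          have : (m : ℝ) - d ≠ 0 := by linarith
          field_simp
          ring
      _ ≤ _ := mul_le_mul_of_nonneg_right this (by linarith)
  have h3 : (m - d : ℝ) ≥ 0 := by linarith
  calc (m : ℝ) ^ (k * d) ≤ (Real.exp (d / (m - d)) * (m - d)) ^ (k * d) := by gcongr
    _ = Real.exp ((k * d : ℕ) * (d / (m - d))) * (((m - d) ^ d : ℝ)) ^ k := by
        rw [mul_pow, ← Real.exp_nat_mul, ← pow_mul, mul_comm d k]
    _ ≤ _ := by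
        refine mul_le_mul (Real.exp_le_exp.2 ?_) (pow_le_pow_left₀ (by positivity) h1 k)
          (by positivity) (Real.exp_pos _).le
        rw [← mul_div_assoc, div_le_iff₀ (by linarith)]
        push_cast
        have hc : 0 ≤ c * m := (Nat.cast_nonneg k).trans hk
        have hcm : 0 ≤ c := nonneg_of_mul_nonneg_left hc (by linarith)
        calc (k : ℝ) * d * d ≤ (c * m) * d * d := by gcongr
          _ ≤ (c * (2 * (m - d))) * d * d := by gcongr; linarith
          _ = _ := by ring

open Filter Topology in
theorem tendsto_card_good_div {c : ℝ} (hc : 0 < c)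
    (Good : ∀ m : ℕ, (Fin ⌊c * m⌋₊ → {s : Finset (Fin m) // s.card = d}) → Prop)
    [∀ m, DecidablePred (Good m)]
    (Bad : ∀ m : ℕ, (Fin ⌊c * m⌋₊ × Fin d → Fin m) → Prop) [∀ m, DecidablePred (Bad m)]
    (h : ∀ m E σ, ¬ Good m E → Bad m (toSlots E σ))
    (hBad : Tendsto (fun m : ℕ => (#(univ.filter (Bad m)) : ℝ) / (m : ℝ) ^ (⌊c * m⌋₊ * d))
      atTop (𝓝 0)) :
    Tendsto (fun m : ℕ => (#(univ.filter (Good m)) : ℝ) /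
      (Fintype.card (Fin ⌊c * m⌋₊ → {s : Finset (Fin m) // s.card = d}) : ℝ)) atTop (𝓝 1) := by
  have hlow := (hBad.const_mul (Real.exp (2 * d ^ 2 * c))).const_sub 1
  rw [mul_zero, sub_zero] at hlow
  refine tendsto_of_tendsto_of_tendsto_of_le_of_le' hlow tendsto_const_nhds ?_
    (Eventually.of_forall fun m => div_le_one_of_le₀
      (by exact_mod_cast card_le_univ _) (Nat.cast_nonneg _))
  filter_upwards [eventually_ge_atTop (2 * d + 1)] with m hm
  set k := ⌊c * m⌋₊ with hk
  have hkc : (k : ℝ) ≤ c * m := Nat.floor_le (by positivity)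
  have hcard : Fintype.card (Fin k → {s : Finset (Fin m) // s.card = d}) = m.choose d ^ k := by
    rw [Fintype.card_fun, Fintype.card_finset_len, Fintype.card_fin, Fintype.card_fin]
  have hle := card_filter_mul_factorial_pow_le (fun E => ¬ Good m E) (Bad m) (h m)
  have hsplit := card_filter_add_card_filter_not (s := univ) (Good m)
  rw [card_univ, hcard] at hsplit
  rw [hcard]
  rw [Fintype.card_fin] at hle
  have hpow := pow_le_exp_mul_descFactorial_pow hkc hm
  have hdf : (m.descFactorial d : ℝ) ^ k = (d.factorial : ℝ) ^ k * (m.choose d : ℝ) ^ k := by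
    rw [← mul_pow, Nat.descFactorial_eq_factorial_mul_choose]; push_cast; rfl
  rw [hdf] at hpow
  have hm0 : (0 : ℝ) < m := by exact_mod_cast (by omega : 0 < m)
  have hC0 : (0 : ℝ) < (m.choose d : ℝ) ^ k := by
    have := Nat.choose_pos (show d ≤ m by omega)
    positivity
  have hsplit' : (#(univ.filter (Good m)) : ℝ) + #(univ.filter fun E => ¬ Good m E) =
      (m.choose d : ℝ) ^ k := by exact_mod_cast hsplit
  have hle' : (#(univ.filter fun E => ¬ Good m E) : ℝ) * (d.factorial : ℝ) ^ k ≤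
      #(univ.filter (Bad m)) := by exact_mod_cast hle
  push_cast
  rw [le_div_iff₀ hC0, ← hsplit', sub_mul, one_mul, add_sub_assoc, add_le_iff_nonpos_right,
    sub_nonpos, hsplit', mul_div_assoc', div_mul_eq_mul_div, le_div_iff₀ (by positivity)]
  set b : ℝ := (#(univ.filter fun E => ¬ Good m E) : ℝ)
  have hf0 : (0 : ℝ) < (d.factorial : ℝ) ^ k := by positivity
  calc b * (m : ℝ) ^ (k * d)
      ≤ b * (Real.exp (2 * d ^ 2 * c) * ((d.factorial : ℝ) ^ k * (m.choose d : ℝ) ^ k)) := by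
        gcongr
    _ = Real.exp (2 * d ^ 2 * c) * (b * (d.factorial : ℝ) ^ k) * (m.choose d : ℝ) ^ k := by ring
    _ ≤ _ := by gcongr

end Transfer

end

section

open Finset

lemma poissonTail_pos (l : ℕ) {μ : ℝ} (hμ : 0 < μ) : 0 < poissonTail l μ := by
  have h : ∑ i ∈ range (l - 1), μ ^ i / i.factorial < Real.exp μ := by
    refine lt_of_lt_of_le ?_ (Real.sum_le_exp_of_nonneg hμ.le (l - 1 + 1))
    rw [sum_range_succ]
    exact lt_add_of_pos_right _ (by positivity)
  rw [poissonTail, sub_pos, Real.exp_neg, inv_mul_lt_iff₀ (Real.exp_pos μ), mul_one]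
  exact h

lemma poissonTail_le_one (l : ℕ) {μ : ℝ} (hμ : 0 ≤ μ) : poissonTail l μ ≤ 1 :=
  sub_le_self _ (by positivity)

lemma poissonTail_le_self {l : ℕ} (hl : 2 ≤ l) {μ : ℝ} (hμ : 0 ≤ μ) : poissonTail l μ ≤ μ := by
  have h1 : (1 : ℝ) ≤ ∑ i ∈ range (l - 1), μ ^ i / i.factorial := by
    have := single_le_sum (f := fun i : ℕ => μ ^ i / (i.factorial : ℝ))
      (fun i _ => by positivity) (mem_range.2 (show 0 < l - 1 by omega))
    simpa using this
  have h2 := Real.add_one_le_exp (-μ)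
  have h3 := le_mul_of_one_le_right (Real.exp_pos (-μ)).le h1
  rw [poissonTail]
  linarith

/-- The critical average degree `Λ` is the infimum of `μ / P(μ) ^ (d - 1)` over positive `μ`, where
`P = poissonTail l`. -/
lemma exists_critical_degree {d l : ℕ} (hd : 2 ≤ d) (hl : 2 ≤ l) :
    ∃ Λ : ℝ, 0 < Λ ∧ (∀ μ, 0 < μ → Λ * poissonTail l μ ^ (d - 1) ≤ μ) ∧
      ∀ r, Λ < r → ∃ μ, 0 < μ ∧ μ < r * poissonTail l μ ^ (d - 1) := by
  have hlow : ∀ x ∈ (fun μ => μ / poissonTail l μ ^ (d - 1)) '' Set.Ioi 0, (1 : ℝ) ≤ x := by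
    rintro _ ⟨μ, hμ, rfl⟩
    rw [Set.mem_Ioi] at hμ
    dsimp only
    rw [one_le_div (pow_pos (poissonTail_pos l hμ) _)]
    exact (pow_le_of_le_one (poissonTail_pos l hμ).le (poissonTail_le_one l hμ.le)
      (by omega)).trans (poissonTail_le_self hl hμ.le)
  have hne : ((fun μ => μ / poissonTail l μ ^ (d - 1)) '' Set.Ioi 0).Nonempty :=
    Set.Nonempty.image _ ⟨1, Set.mem_Ioi.2 one_pos⟩
  refine ⟨_, one_pos.trans_le (le_csInf hne hlow), fun μ hμ => ?_, fun r hr => ?_⟩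
  · rw [← le_div_iff₀ (pow_pos (poissonTail_pos l hμ) _)]
    exact csInf_le ⟨1, hlow⟩ ⟨μ, hμ, rfl⟩
  · obtain ⟨_, ⟨μ, hμ, rfl⟩, hlt⟩ := exists_lt_of_csInf_lt hne hr
    exact ⟨μ, hμ, (div_lt_iff₀ (pow_pos (poissonTail_pos l hμ) _)).1 hlt⟩

lemma exists_supercritical_time {d l : ℕ} (hd : 2 ≤ d) {r μ a : ℝ} (hr : 0 < r) (hμ : 0 < μ)
    (h : μ < r * poissonTail l μ ^ (d - 1)) (ha : a = ((d : ℝ) - 1) / d) :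
    ∃ s, 0 < s ∧ s ≤ 1 ∧ r * s ^ a = μ ∧ r * s < μ * poissonTail l μ := by
  have hd' : (2 : ℝ) ≤ d := by exact_mod_cast hd
  have hd1 : (0 : ℝ) < d - 1 := by linarith
  have hP := poissonTail_pos l hμ
  have hθ0 : 0 < μ / r := by positivity
  have hθ : μ / r < poissonTail l μ ^ (d - 1) := by rwa [div_lt_iff₀' hr]
  have hroot : (μ / r) ^ ((d : ℝ) - 1)⁻¹ < poissonTail l μ := by
    calc (μ / r) ^ ((d : ℝ) - 1)⁻¹ < (poissonTail l μ ^ (d - 1)) ^ ((d : ℝ) - 1)⁻¹ :=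
          Real.rpow_lt_rpow hθ0.le hθ (by positivity)
      _ = poissonTail l μ := by
          rw [← Real.rpow_natCast, ← Real.rpow_mul hP.le, Nat.cast_sub (by omega), Nat.cast_one,
            mul_inv_cancel₀ hd1.ne', Real.rpow_one]
  refine ⟨(μ / r) ^ ((d : ℝ) / (d - 1)), by positivity,
    Real.rpow_le_one hθ0.le (hθ.le.trans (pow_le_one₀ hP.le (poissonTail_le_one l hμ.le)))
      (by positivity), ?_, ?_⟩
  · rw [← Real.rpow_mul hθ0.le, ha, show (d : ℝ) / (d - 1) * ((d - 1) / d) = 1 by field_simp,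
      Real.rpow_one, mul_div_cancel₀ _ hr.ne']
  · rw [show (d : ℝ) / (d - 1) = 1 + ((d : ℝ) - 1)⁻¹ by field_simp; ring,
      Real.rpow_add hθ0, Real.rpow_one, ← mul_assoc, mul_div_cancel₀ _ hr.ne']
    exact mul_lt_mul_of_pos_left hroot hμ

lemma exists_subcritical_ratio {d l : ℕ} (hd : 2 ≤ d) {r Λ a : ℝ} (hr : 0 < r) (hrΛ : r < Λ)
    (h : ∀ μ, 0 < μ → Λ * poissonTail l μ ^ (d - 1) ≤ μ) (ha : a = ((d : ℝ) - 1) / d) :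
    ∃ κ, 0 < κ ∧ κ < 1 ∧
      ∀ s, 0 < s → r * s ^ a * poissonTail l (r * s ^ a) ≤ κ * (r * s) := by
  have hd' : (2 : ℝ) ≤ d := by exact_mod_cast hd
  have hd1 : (0 : ℝ) < d - 1 := by linarith
  have hΛ : 0 < Λ := hr.trans hrΛ
  refine ⟨(r / Λ) ^ ((d : ℝ) - 1)⁻¹, by positivity,
    Real.rpow_lt_one (by positivity) ((div_lt_one hΛ).2 hrΛ) (by positivity), fun s hs => ?_⟩
  have hμ : 0 < r * s ^ a := by positivity
  have hP := poissonTail_pos l hμ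
  have h1 : poissonTail l (r * s ^ a) ^ (d - 1) ≤ r / Λ * s ^ a := by
    rw [div_mul_eq_mul_div, le_div_iff₀' hΛ]
    exact h _ hμ
  have h2 : poissonTail l (r * s ^ a) ≤ (r / Λ) ^ ((d : ℝ) - 1)⁻¹ * s ^ ((d : ℝ)⁻¹) := by
    calc poissonTail l (r * s ^ a) = (poissonTail l (r * s ^ a) ^ (d - 1)) ^ ((d : ℝ) - 1)⁻¹ := by
          rw [← Real.rpow_natCast, ← Real.rpow_mul hP.le, Nat.cast_sub (by omega), Nat.cast_one,
            mul_inv_cancel₀ hd1.ne', Real.rpow_one]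
      _ ≤ (r / Λ * s ^ a) ^ ((d : ℝ) - 1)⁻¹ :=
          Real.rpow_le_rpow (by positivity) h1 (by positivity)
      _ = _ := by
          rw [Real.mul_rpow (by positivity) (by positivity), ← Real.rpow_mul hs.le, ha]
          congr 2
          field_simp
  calc r * s ^ a * poissonTail l (r * s ^ a)
      ≤ r * s ^ a * ((r / Λ) ^ ((d : ℝ) - 1)⁻¹ * s ^ ((d : ℝ)⁻¹)) := by gcongr
    _ = (r / Λ) ^ ((d : ℝ) - 1)⁻¹ * (r * (s ^ a * s ^ ((d : ℝ)⁻¹))) := by ring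
    _ = _ := by
        rw [← Real.rpow_add hs, ha, show ((d : ℝ) - 1) / d + (d : ℝ)⁻¹ = 1 by field_simp; ring,
          Real.rpow_one]

end

section

open Finset Filter Topology

open Classical in
/-- An event for `⌊cm⌋ * d` independent uniform points of `Fin m` has vanishing probability. -/
def Negligible {d : ℕ} {c : ℝ} (Bad : ∀ m : ℕ, (Fin ⌊c * m⌋₊ × Fin d → Fin m) → Prop) : Prop :=
  Tendsto (fun m : ℕ => (#(univ.filter (Bad m)) : ℝ) / (m : ℝ) ^ (⌊c * m⌋₊ * d)) atTop (𝓝 0)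

lemma negligible_iff {d : ℕ} {c : ℝ} {Bad : ∀ m : ℕ, (Fin ⌊c * m⌋₊ × Fin d → Fin m) → Prop}
    [∀ m, DecidablePred (Bad m)] : Negligible Bad ↔
      Tendsto (fun m : ℕ => (#(univ.filter (Bad m)) : ℝ) / (m : ℝ) ^ (⌊c * m⌋₊ * d))
        atTop (𝓝 0) := by
  unfold Negligible
  convert Iff.rfl

lemma Negligible.of_imp_or {d : ℕ} {c : ℝ}
    {Bad Bad₁ Bad₂ : ∀ m : ℕ, (Fin ⌊c * m⌋₊ × Fin d → Fin m) → Prop}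
    (h₁ : Negligible Bad₁) (h₂ : Negligible Bad₂)
    (h : ∀ᶠ m in atTop, ∀ f, Bad m f → Bad₁ m f ∨ Bad₂ m f) : Negligible Bad := by
  classical
  have h₁₂ := Tendsto.add (negligible_iff.1 h₁) (negligible_iff.1 h₂)
  rw [add_zero] at h₁₂
  refine negligible_iff.2 <|
    tendsto_of_tendsto_of_tendsto_of_le_of_le' tendsto_const_nhds h₁₂
      (Eventually.of_forall fun m => by positivity) ?_
  filter_upwards [h] with m hm
  rw [← add_div]
  gcongr
  have : univ.filter (Bad m) ⊆ univ.filter (Bad₁ m) ∪ univ.filter (Bad₂ m) := by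
    intro f hf
    simpa using hm f (mem_filter.1 hf).2
  exact_mod_cast (card_le_card this).trans (card_union_le _ _)

lemma mul_card_le_sum_coreWeight {K V : Type*} [Fintype V] [DecidableEq V] {d l : ℕ}
    {f : K × Fin d → V} {T I : Finset K} (hT : IsCore l f T) (hTI : T ⊆ I) :
    (d : ℝ) * #T ≤ ∑ v, coreWeight l (degIn f (I ×ˢ univ) v) := by
  have h : ∑ v, (degIn f (T ×ˢ univ) v : ℝ) = d * #T := by
    rw [← Nat.cast_sum, sum_degIn, card_product, card_univ, Fintype.card_fin]
    push_cast
    ring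
  rw [← h]
  refine sum_le_sum fun v _ => ?_
  have hle := degIn_mono f (product_subset_product_left (t := univ) hTI) v
  by_cases hv : degIn f (T ×ˢ univ) v = 0
  · rw [hv, Nat.cast_zero]
    exact coreWeight_nonneg _ _
  · rw [coreWeight, if_pos ((hT v hv).trans hle)]
    exact_mod_cast hle

lemma sum_coreWeight_le {K V : Type*} [Fintype V] [DecidableEq V] {d l : ℕ}
    (f : K × Fin d → V) (I : Finset K) :
    ∑ v, coreWeight l (degIn f (I ×ˢ univ) v) ≤ d * #I := by
  have h : ∑ v, (degIn f (I ×ˢ univ) v : ℝ) = d * #I := by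
    rw [← Nat.cast_sum, sum_degIn, card_product, card_univ, Fintype.card_fin]
    push_cast
    ring
  rw [← h]
  exact sum_le_sum fun v _ => coreWeight_le _ _

lemma eventually_lt_edges {c x : ℝ} (hc : 0 < c) (hx : x < c) :
    ∀ᶠ m : ℕ in atTop, x * m < ⌊c * m⌋₊ := by
  filter_upwards [(tendsto_edges_div hc).eventually_const_lt hx, eventually_ge_atTop 1]
    with m hm hm1
  rwa [lt_div_iff₀ (by exact_mod_cast hm1)] at hm

lemma negligible_exists_core_of_ratio {d l : ℕ} (hd : 2 ≤ d) (hl : 2 ≤ l) {c κ τ a : ℝ}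
    (hc : 0 < c) (hκτ : κ < τ) (hτ0 : 0 < τ) (hτ : τ < 1)
    (ha : a = ((d : ℝ) - 1) / d)
    (h : ∀ s, 0 < s → c * d * s ^ a * poissonTail l (c * d * s ^ a) ≤ κ * (c * d * s)) (j : ℕ) :
    Negligible fun (m : ℕ) (f : Fin ⌊c * m⌋₊ × Fin d → Fin m) =>
      ∃ T, IsCore l f T ∧ τ ^ j * ⌊c * m⌋₊ < #T := by
  have hd0 : (0 : ℝ) < d := by exact_mod_cast (by omega : 0 < d)
  induction j with
  | zero =>
    classical
    refine negligible_iff.2 (tendsto_const_nhds.congr fun m => ?_)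
    rw [filter_false_of_mem, card_empty, Nat.cast_zero, zero_div]
    rintro f - ⟨T, -, hT⟩
    have := card_le_univ T
    rw [Fintype.card_fin] at this
    have : (#T : ℝ) ≤ ⌊c * m⌋₊ := by exact_mod_cast this
    linarith
  | succ j ih =>
    set s := τ ^ j with hs
    have hs0 : 0 < s := by positivity
    have key : Negligible fun (m : ℕ) (f : Fin ⌊c * m⌋₊ × Fin d → Fin m) =>
        (∃ T, IsCore l f T ∧ τ * s * ⌊c * m⌋₊ < #T) ∧
          ∀ T, IsCore l f T → (#T : ℝ) ≤ s * ⌊c * m⌋₊ := by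
      classical
      refine negligible_iff.2 <| tendsto_card_bad_div hd (one_le_two.trans hl)
        (γ := (τ - κ) / 2 * (c * d * s)) hc hs0 (pow_le_one₀ hτ0.le hτ.le) (mul_pos (by linarith) (by positivity)) ha _
        (Eventually.of_forall fun m f I hI hcore hBad => ?_) ?_
      · have := hBad.2 I hcore
        rw [Nat.floor_lt (by positivity)] at hI
        linarith
      · have hx : (κ + τ) / (2 * τ) * c < c := by
          refine mul_lt_of_lt_one_left hc ?_
          rw [div_lt_one (by positivity)]
          linarith
        filter_upwards [eventually_lt_edges hc hx] with m hm f I _ hIT habs hBad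
        obtain ⟨T, hT, hlarge⟩ := hBad.1
        have h1 := mul_card_le_sum_coreWeight hT (hIT T hT)
        have h2 := (abs_lt.1 habs).2
        have h3 := mul_le_mul_of_nonneg_right (h s hs0) (Nat.cast_nonneg (α := ℝ) m)
        have h4 : (d : ℝ) * (τ * s * ⌊c * m⌋₊) < d * #T := mul_lt_mul_of_pos_left hlarge hd0
        have h5 : d * (τ * s) * ((κ + τ) / (2 * τ) * c * m) < d * (τ * s) * ⌊c * m⌋₊ :=
          mul_lt_mul_of_pos_left hm (by positivity)
        have h6 : d * (τ * s) * ((κ + τ) / (2 * τ) * c * m) =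
            (κ * (c * d * s)) * m + (τ - κ) / 2 * (c * d * s) * m := by
          field_simp
          ring
        linarith
    refine ih.of_imp_or key (Eventually.of_forall fun m f => ?_)
    rintro ⟨T, hT, hlarge⟩
    by_cases hall : ∀ T, IsCore l f T → (#T : ℝ) ≤ s * ⌊c * m⌋₊
    · exact Or.inr ⟨⟨T, hT, by rwa [pow_succ'] at hlarge⟩, hall⟩
    · push Not at hall
      exact Or.inl hall

theorem negligible_exists_core {d l : ℕ} (hd : 2 ≤ d) (hl : 2 ≤ l) (hdl : 4 < d + l)
    {c Λ : ℝ} (hc : 0 < c) (hΛ : ∀ μ, 0 < μ → Λ * poissonTail l μ ^ (d - 1) ≤ μ)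
    (hcΛ : c * d < Λ) :
    Negligible fun (m : ℕ) (f : Fin ⌊c * m⌋₊ × Fin d → Fin m) =>
      ∃ T : Finset (Fin ⌊c * m⌋₊), T.Nonempty ∧ IsCore l f T := by
  have hd0 : (0 : ℝ) < d := by exact_mod_cast (by omega : 0 < d)
  obtain ⟨κ, hκ0, hκ1, hκ⟩ := exists_subcritical_ratio hd (by positivity) hcΛ hΛ rfl
  obtain ⟨τ, hκτ, hτ⟩ := exists_between hκ1
  obtain ⟨δ, hδ0, -, hδ⟩ := exists_small_cores_negligible hd hl hdl hc
  obtain ⟨J, hJ⟩ := exists_pow_lt_of_lt_one hδ0 hτ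
  classical
  have hsmall : Negligible fun (m : ℕ) (f : Fin ⌊c * m⌋₊ × Fin d → Fin m) =>
      ∃ T : Finset (Fin ⌊c * m⌋₊), T.Nonempty ∧ (#T : ℝ) ≤ δ * ⌊c * m⌋₊ ∧ IsCore l f T :=
    negligible_iff.2 (hδ _ fun m f h => h)
  refine (negligible_exists_core_of_ratio hd hl hc hκτ (hκ0.trans hκτ) hτ rfl hκ J).of_imp_or
    hsmall (Eventually.of_forall fun m f => ?_)
  rintro ⟨T, hTne, hT⟩
  rcases lt_or_ge (τ ^ J * ⌊c * m⌋₊) (#T : ℝ) with hlt | hge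
  · exact Or.inl ⟨T, hT, hlt⟩
  · exact Or.inr ⟨T, hTne, hge.trans (by gcongr), hT⟩

lemma exists_negligible_excess {d : ℕ} {c A : ℝ} (hc : 0 < c) (hA : 0 < A) :
    ∃ D : ℕ, 0 < D ∧ Negligible fun (m : ℕ) (f : Fin ⌊c * m⌋₊ × Fin d → Fin m) =>
      A * m < ∑ v, ((degIn f univ v - D : ℕ) : ℝ) := by
  obtain ⟨D, hD⟩ := exists_nat_gt (2 * (c * d) ^ 2 / A)
  have hD0 : (0 : ℝ) < D := lt_of_le_of_lt (by positivity) hD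
  have hstep : ∀ j : ℕ, |((j + 1 - D : ℕ) : ℝ) - ((j - D : ℕ) : ℝ)| ≤ 1 := by
    intro j
    rcases le_or_gt D j with h | h
    · rw [show j + 1 - D = (j - D) + 1 by omega]; simp
    · rw [show j + 1 - D = 0 by omega, show j - D = 0 by omega]; simp
  have hexc : ∀ j : ℕ, ((j - D : ℕ) : ℝ) ≤ (D : ℝ)⁻¹ * (j * (j - 1)) := by
    intro j
    rcases le_or_gt j D with h | h
    · rw [show j - D = 0 by omega, Nat.cast_zero]
      rcases j.eq_zero_or_pos with rfl | hj
      · simp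
      · have : (1 : ℝ) ≤ j := by exact_mod_cast hj
        exact mul_nonneg (by positivity) (mul_nonneg (by positivity) (by linarith))
    · have h1 : (D : ℝ) ≤ j - 1 := by
        have : (D : ℝ) + 1 ≤ j := by exact_mod_cast h
        linarith
      rw [le_inv_mul_iff₀ hD0, mul_comm]
      exact mul_le_mul (by exact_mod_cast Nat.sub_le j D) h1 (by positivity) (by positivity)
  refine ⟨D, by exact_mod_cast hD0, ?_⟩
  have hlim : Tendsto (fun m : ℕ => 16 * (c * d) / A ^ 2 * (m : ℝ)⁻¹) atTop (𝓝 0) := by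
    simpa using (tendsto_inv_atTop_nhds_zero_nat (𝕜 := ℝ)).const_mul (16 * (c * d) / A ^ 2)
  refine negligible_iff.2 <|
    tendsto_of_tendsto_of_tendsto_of_le_of_le' tendsto_const_nhds hlim
      (Eventually.of_forall fun m => by positivity) ?_
  filter_upwards [eventually_ge_atTop 1] with m hm
  have hm0 : (0 : ℝ) < m := by exact_mod_cast hm
  have hne : Nonempty (Fin m) := ⟨⟨0, hm⟩⟩
  have hvar := sum_sq_sum_degIn_sub_le (ι := Fin ⌊c * m⌋₊ × Fin d) (V := Fin m)
    (h := fun j => ((j - D : ℕ) : ℝ)) hstep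
  have hpair := sum_sum_degIn_mul_pred_le (ι := Fin ⌊c * m⌋₊ × Fin d) (V := Fin m)
  simp only [Fintype.card_prod, Fintype.card_fin] at hvar hpair
  have hkc : (⌊c * m⌋₊ : ℝ) ≤ c * m := Nat.floor_le (by positivity)
  have hN : ((⌊c * m⌋₊ * d : ℕ) : ℝ) ≤ c * d * m := by
    push_cast
    calc (⌊c * m⌋₊ : ℝ) * d ≤ c * m * d := by gcongr
      _ = _ := by ring
  have hM : (0 : ℝ) < (m : ℝ) ^ (⌊c * m⌋₊ * d) := by positivity
  set M := (m : ℝ) ^ (⌊c * m⌋₊ * d) with hMdef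
  set X : (Fin ⌊c * m⌋₊ × Fin d → Fin m) → ℝ := fun f => ∑ v, ((degIn f univ v - D : ℕ) : ℝ)
    with hX
  set e : ℝ := (∑ f, X f) / M with he
  have hmean : e ≤ A * m / 2 := by
    rw [he, div_le_iff₀ hM]
    calc ∑ f, X f ≤ ∑ f : Fin ⌊c * m⌋₊ × Fin d → Fin m, (D : ℝ)⁻¹ *
          ∑ v, ((degIn f univ v : ℝ) * (degIn f univ v - 1)) := by
          refine sum_le_sum fun f _ => ?_
          rw [mul_sum]
          exact sum_le_sum fun v _ => hexc _
      _ ≤ (D : ℝ)⁻¹ * (M * (((⌊c * m⌋₊ * d : ℕ) : ℝ) ^ 2 / m)) := by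
          rw [← mul_sum]
          gcongr
      _ ≤ (D : ℝ)⁻¹ * (M * ((c * d * m) ^ 2 / m)) := by gcongr
      _ = (c * d) ^ 2 / D * m * M := by field_simp
      _ ≤ A * m / 2 * M := by
          rw [div_lt_iff₀ hA] at hD
          rw [mul_div_right_comm A]
          refine mul_le_mul_of_nonneg_right (mul_le_mul_of_nonneg_right ?_ hm0.le) hM.le
          rw [div_le_iff₀ hD0]
          linarith
  have hcheb : (#(univ.filter fun f => A * m < X f) : ℝ) * (A * m / 2) ^ 2 ≤
      4 * (c * d * m) * M := by
    calc (#(univ.filter fun f => A * m < X f) : ℝ) * (A * m / 2) ^ 2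
        = ∑ f with A * m < X f, (A * m / 2) ^ 2 := by rw [sum_const, nsmul_eq_mul]
      _ ≤ ∑ f with A * m < X f, (X f - e) ^ 2 := by
          refine sum_le_sum fun f hf => ?_
          have := (mem_filter.1 hf).2
          gcongr
          linarith
      _ ≤ ∑ f, (X f - e) ^ 2 :=
          sum_le_sum_of_subset_of_nonneg (filter_subset _ _) fun _ _ _ => sq_nonneg _
      _ ≤ _ := hvar
      _ ≤ c * d * m * (2 * 1) ^ 2 * M := by gcongr
      _ = _ := by ring
  rw [div_le_iff₀ hM]
  have hpos : 0 < (A * m / 2) ^ 2 := by positivity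
  have hfin : 16 * (c * d) / A ^ 2 * (m : ℝ)⁻¹ * M * (A * m / 2) ^ 2 = 4 * (c * d * m) * M := by
    field_simp
    ring
  refine le_of_mul_le_mul_right ?_ hpos
  rw [hfin]
  convert hcheb

theorem exists_negligible_not_large_core {d l : ℕ} (hd : 2 ≤ d) (hl : 1 ≤ l)
    {c μ : ℝ} (hc : 0 < c) (hμ : 0 < μ) (h : μ < c * d * poissonTail l μ ^ (d - 1)) :
    ∃ ε : ℝ, 0 < ε ∧ Negligible fun (m : ℕ) (f : Fin ⌊c * m⌋₊ × Fin d → Fin m) =>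
      ¬ ∃ T : Finset (Fin ⌊c * m⌋₊), IsCore l f T ∧ ε * m ≤ #((T ×ˢ univ).image f) := by
  have hd0 : (0 : ℝ) < d := by exact_mod_cast (by omega : 0 < d)
  obtain ⟨s, hs0, hs1, hsμ, hlt⟩ := exists_supercritical_time hd (by positivity) hμ h rfl
  set A := c * d * s / 4 with hA
  obtain ⟨D, hD, hexc⟩ := exists_negligible_excess (d := d) (A := A) hc (by positivity)
  have hD0 : (0 : ℝ) < D := by exact_mod_cast hD
  refine ⟨A / D, by positivity, ?_⟩
  have key : Negligible fun (m : ℕ) (f : Fin ⌊c * m⌋₊ × Fin d → Fin m) =>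
      (¬ ∃ T : Finset (Fin ⌊c * m⌋₊), IsCore l f T ∧ A / D * m ≤ #((T ×ˢ univ).image f)) ∧
        ∑ v, ((degIn f univ v - D : ℕ) : ℝ) ≤ A * m := by
    classical
    refine negligible_iff.2 <| tendsto_card_bad_div hd hl
      (γ := μ * poissonTail l μ - c * d * s) hc hs0 hs1 (by linarith) rfl _ ?_ (Eventually.of_forall fun m f I hI _ habs _ => ?_)
    · filter_upwards [eventually_lt_edges hc (half_lt_self hc)] with m hm f I hI hcore hBad
      refine hBad.1 ⟨I, hcore, ?_⟩
      rw [Nat.floor_lt (by positivity)] at hI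
      have hdeg : ∑ v, (degIn f (I ×ˢ univ) v : ℝ) = d * #I := by
        rw [← Nat.cast_sum, sum_degIn, card_product, card_univ, Fintype.card_fin]
        push_cast
        ring
      have hpt : ∀ v, (degIn f (I ×ˢ univ) v : ℝ) ≤ ((degIn f univ v - D : ℕ) : ℝ) +
          if v ∈ (I ×ˢ univ).image f then (D : ℝ) else 0 := by
        intro v
        have h1 := degIn_mono f (subset_univ (I ×ˢ univ)) v
        split_ifs with hv
        · have : degIn f (I ×ˢ univ) v ≤ (degIn f univ v - D) + D := by omega
          exact_mod_cast this
        · have : degIn f (I ×ˢ univ) v = 0 := by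
            refine card_eq_zero.2 (filter_eq_empty_iff.2 fun p hp hpv => hv ?_)
            exact mem_image.2 ⟨p, hp, hpv⟩
          rw [this, Nat.cast_zero, add_zero]
          exact Nat.cast_nonneg _
      have hsum := sum_le_sum fun v (_ : v ∈ univ) => hpt v
      rw [hdeg, sum_add_distrib, sum_ite_mem, univ_inter, sum_const, nsmul_eq_mul] at hsum
      have h2 : d * (s * (c / 2 * m)) < d * (#I : ℝ) := by
        refine mul_lt_mul_of_pos_left (lt_trans ?_ hI) hd0
        gcongr
      have h3 := hBad.2
      rw [div_mul_eq_mul_div, div_le_iff₀ hD0]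
      rw [hA] at h3 ⊢
      linarith
    · have h1 : (d : ℝ) * #I ≤ c * d * s * m := by
        have h2 : (⌊s * ⌊c * m⌋₊⌋₊ : ℝ) ≤ s * ⌊c * m⌋₊ := Nat.floor_le (by positivity)
        have h3 : (⌊c * m⌋₊ : ℝ) ≤ c * m := Nat.floor_le (by positivity)
        rw [hI]
        calc (d : ℝ) * ⌊s * ⌊c * m⌋₊⌋₊ ≤ d * (s * (c * m)) := by
              refine mul_le_mul_of_nonneg_left (h2.trans ?_) hd0.le
              gcongr
          _ = _ := by ring
      have h4 := sum_coreWeight_le (l := l) f I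
      have h5 := (abs_lt.1 habs).1
      rw [hsμ] at h5
      linarith
  refine hexc.of_imp_or key (Eventually.of_forall fun m f hf => ?_)
  rcases lt_or_ge (A * m) (∑ v, ((degIn f univ v - D : ℕ) : ℝ)) with hlt | hge
  · exact Or.inl hlt
  · exact Or.inr ⟨hf, hge⟩

end

end CoreThreshold

/- STATEMENT 12: For integers `d, l ≥ 2` with `d + l > 4`, there is a threshold constant
`c*_{d,l} > 0` for the appearance of an `l`-core in a random `d`-uniform hypergraph with
`k = ⌊cm⌋` hyperedges on `m` vertices (hyperedges chosen independently and uniformly among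
`d`-element subsets; probabilities computed by counting). A subfamily `T` of hyperedge
indices is an `l`-core-set if every vertex covered by a hyperedge of `T` belongs to at least
`l` hyperedges of `T`; the `l`-core is empty iff every such `T` is empty, and the `l`-core
covers at least `εm` vertices iff some such `T` covers at least `εm` vertices.
For `c < c*`: empty `l`-core with probability `1 − o(1)`; for `c > c*`: some `ε > 0` with
the `l`-core covering at least `εm` vertices with probability `1 − o(1)`. -/
open Classical in
theorem stmt12 (d l : ℕ) (hd : 2 ≤ d) (hl : 2 ≤ l) (hdl : 4 < d + l) :
    ∃ cstar : ℝ, 0 < cstar ∧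
      ∀ c : ℝ, 0 < c →
        (c < cstar →
          Filter.Tendsto
            (fun m : ℕ =>
              ((Finset.filter
                  (fun E : Fin ⌊c * m⌋₊ → {s : Finset (Fin m) // s.card = d} =>
                    ∀ T : Finset (Fin ⌊c * m⌋₊),
                      (∀ v : Fin m, (∃ t ∈ T, v ∈ (E t).1) →
                        l ≤ (T.filter fun t => v ∈ (E t).1).card) → T = ∅)
                  Finset.univ).card : ℝ) /
                (Fintype.card (Fin ⌊c * m⌋₊ → {s : Finset (Fin m) // s.card = d}) : ℝ))
            Filter.atTop (nhds 1)) ∧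
        (cstar < c →
          ∃ ε : ℝ, 0 < ε ∧
            Filter.Tendsto
              (fun m : ℕ =>
                ((Finset.filter
                    (fun E : Fin ⌊c * m⌋₊ → {s : Finset (Fin m) // s.card = d} =>
                      ∃ T : Finset (Fin ⌊c * m⌋₊),
                        (∀ v : Fin m, (∃ t ∈ T, v ∈ (E t).1) →
                          l ≤ (T.filter fun t => v ∈ (E t).1).card) ∧
                        ε * m ≤ ((T.biUnion fun t => (E t).1).card : ℝ))
                    Finset.univ).card : ℝ) /
                  (Fintype.card (Fin ⌊c * m⌋₊ → {s : Finset (Fin m) // s.card = d}) : ℝ))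
              Filter.atTop (nhds 1)) := by
  have hd0 : (0 : ℝ) < d := by exact_mod_cast (by omega : 0 < d)
  obtain ⟨Λ, hΛ0, hsub, hsup⟩ := CoreThreshold.exists_critical_degree hd hl
  refine ⟨Λ / d, div_pos hΛ0 hd0, fun c hc => ⟨fun hlt => ?_, fun hlt => ?_⟩⟩
  · have key := CoreThreshold.negligible_exists_core hd hl hdl hc hsub ((lt_div_iff₀ hd0).1 hlt)
    have := CoreThreshold.tendsto_card_good_div hc
      (fun m E => ∀ T : Finset (Fin ⌊c * m⌋₊), (∀ v : Fin m, (∃ t ∈ T, v ∈ (E t).1) →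
        l ≤ (T.filter fun t => v ∈ (E t).1).card) → T = ∅) _ (fun m E σ h => ?_)
      (CoreThreshold.negligible_iff.1 key)
    · convert this
    · push Not at h
      obtain ⟨T, hT, hne⟩ := h
      exact ⟨T, hne, (CoreThreshold.isCore_toSlots_iff E σ T).2 fun v ⟨t, ht, hv⟩ =>
        by convert hT v ⟨t, ht, hv⟩⟩
  · obtain ⟨μ, hμ0, hμ⟩ := hsup _ ((div_lt_iff₀ hd0).1 hlt)
    obtain ⟨ε, hε, key⟩ :=
      CoreThreshold.exists_negligible_not_large_core hd (one_le_two.trans hl) hc hμ0 hμ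
    refine ⟨ε, hε, ?_⟩
    have := CoreThreshold.tendsto_card_good_div hc
      (fun m E => ∃ T : Finset (Fin ⌊c * m⌋₊), (∀ v : Fin m, (∃ t ∈ T, v ∈ (E t).1) →
        l ≤ (T.filter fun t => v ∈ (E t).1).card) ∧
          ε * m ≤ ((T.biUnion fun t => (E t).1).card : ℝ)) _ (fun m E σ h => ?_)
      (CoreThreshold.negligible_iff.1 key)
    · convert this
    · rintro ⟨T, hT, hcov⟩
      rw [CoreThreshold.image_toSlots] at hcov
      rw [CoreThreshold.isCore_toSlots_iff] at hT
      exact h ⟨T, fun v hv => by convert hT v hv, by convert hcov⟩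
end
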